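/- Let u be a local minimizer of J in B₁ with 0 ≤ u ≤ 1, under assumption (H1), assume δ(x) ≥ δ₀ > 0 on B₁, and assume δ and γ are differentiable on B₁, γ is Hölder continuous on B₁ with some exponent μ ∈ (0,1), and for some r₀ ∈ (0,1/2) and z₀ ∈ F(u) ∩ B_{1/2} the integrability conditions ∫₀^{r₀} t^{−n} ( ∫_{B_t(z₀)} |Dδ(x)| dx ) dt < ∞ and ∫₀^{r₀} t^{−n} |ln t| ( ∫_{B_t(z₀)} |Dγ(x)| dx ) dt < ∞ hold. Set β(z₀) := 2/(2 − γ(z₀)). Suppose there are a sequence r_j → 0⁺ and a continuous function u₀ : ℝⁿ → ℝ such that the rescalings u_{r_j}(x) := u(z₀ + r_j x)/r_j^{β(z₀)} converge to u₀ uniformly on every compact subset of ℝⁿ. Then u₀ is β(z₀)-homogeneous: u₀(λx) = λ^{β(z₀)} u₀(x) for every λ > 0 and every x ∈ ℝⁿ. -/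

import Mathlib

open Metric MeasureTheory Set Real

noncomputable section

/-- The energy functional `J(v, O) = ∫_O ( ½|Dv|² + δ(x) (v⁺)^{γ(x)} ) dx`,
where the gradient is the a.e.-defined gradient of a Lipschitz function
(realized via `gradient`, which vanishes at points of non-differentiability). -/
def energyJ {n : ℕ} (δ γ u : EuclideanSpace ℝ (Fin n) → ℝ)
    (O : Set (EuclideanSpace ℝ (Fin n))) : ℝ :=
  ∫ x in O, ((1:ℝ)/2 * ‖gradient u x‖ ^ 2 + δ x * (max (u x) 0) ^ (γ x))

/-- A Lipschitz function `u` is a local minimizer of `J` in the unit ball `B₁` if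
`J(u,B₁) ≤ J(v,B₁)` for every Lipschitz `v` such that `{v ≠ u}` is contained in a
compact subset of `B₁`. -/
def IsLocalMinimizer {n : ℕ} (δ γ u : EuclideanSpace ℝ (Fin n) → ℝ) : Prop :=
  (∃ K, LipschitzWith K u) ∧
  ∀ v : EuclideanSpace ℝ (Fin n) → ℝ, (∃ K, LipschitzWith K v) →
    (∃ K : Set (EuclideanSpace ℝ (Fin n)), IsCompact K ∧
        K ⊆ ball (0 : EuclideanSpace ℝ (Fin n)) 1 ∧ {x | v x ≠ u x} ⊆ K) →
    energyJ δ γ u (ball (0 : EuclideanSpace ℝ (Fin n)) 1) ≤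
      energyJ δ γ v (ball (0 : EuclideanSpace ℝ (Fin n)) 1)

/-- The free boundary `F(u) = ∂{x ∈ B₁ : u(x) > 0} ∩ B₁`. -/
def freeBoundary {n : ℕ} (u : EuclideanSpace ℝ (Fin n) → ℝ) :
    Set (EuclideanSpace ℝ (Fin n)) :=
  frontier {x ∈ ball (0 : EuclideanSpace ℝ (Fin n)) 1 | 0 < u x} ∩
    ball (0 : EuclideanSpace ℝ (Fin n)) 1

set_option linter.unusedSectionVars false


section Polar
variable {E : Type*} [NormedAddCommGroup E] [InnerProductSpace ℝ E] [FiniteDimensional ℝ E]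
  [CompleteSpace E] [MeasurableSpace E] [BorelSpace E] (ν : Measure E) [ν.IsAddHaarMeasure]

/-- a bounded measurable function on a product with a sphere is integrable -/
theorem aux_integrable_prod {k : sphere (0:E) 1 × ℝ → ℝ} {a b C : ℝ} (hk : Measurable k)
    (hb : ∀ θ, ∀ r ∈ Ioc a b, |k (θ, r)| ≤ C) :
    Integrable k (ν.toSphere.prod (volume.restrict (Ioc a b))) := by
  refine Integrable.mono' (integrable_const C) hk.aestronglyMeasurable ?_
  have : ∀ᵐ q ∂(ν.toSphere.prod (volume.restrict (Ioc a b))), q.2 ∈ Ioc a b := by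
    have h1 : ∀ᵐ r ∂(volume.restrict (Ioc a b)), r ∈ Ioc a b := ae_restrict_mem measurableSet_Ioc
    exact Measure.quasiMeasurePreserving_snd.ae h1
  filter_upwards [this] with q hq
  exact hb q.1 q.2 hq

theorem aux_swap {k : sphere (0:E) 1 × ℝ → ℝ} {a b C : ℝ} (hab : a ≤ b) (hk : Measurable k)
    (hb : ∀ θ, ∀ r ∈ Ioc a b, |k (θ, r)| ≤ C) :
    ∫ θ, (∫ r in a..b, k (θ, r)) ∂ν.toSphere = ∫ r in a..b, (∫ θ, k (θ, r) ∂ν.toSphere) := by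
  simp only [intervalIntegral.integral_of_le hab]
  exact integral_integral_swap (f := fun θ r => k (θ, r)) (aux_integrable_prod ν hk hb)

theorem aux_intervalIntegrable {k : sphere (0:E) 1 × ℝ → ℝ} {a b C : ℝ} (hab : a ≤ b)
    (hk : Measurable k) (hb : ∀ θ, ∀ r ∈ Ioc a b, |k (θ, r)| ≤ C) :
    IntervalIntegrable (fun r => ∫ θ, k (θ, r) ∂ν.toSphere) volume a b := by
  rw [intervalIntegrable_iff_integrableOn_Ioc_of_le hab]
  exact (aux_integrable_prod ν hk hb).integral_prod_right

theorem aux_integrable_left {k : sphere (0:E) 1 × ℝ → ℝ} {a b C : ℝ} (hab : a ≤ b)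
    (hk : Measurable k) (hb : ∀ θ, ∀ r ∈ Ioc a b, |k (θ, r)| ≤ C) :
    Integrable (fun θ => ∫ r in a..b, k (θ, r)) ν.toSphere := by
  simp only [intervalIntegral.integral_of_le hab]
  exact (aux_integrable_prod ν hk hb).integral_prod_left


theorem polar_lintegral {F : E → ENNReal} (hF : Measurable F) [Nontrivial E] :
    ∫⁻ x, F x ∂ν = ∫⁻ θ, (∫⁻ r in Ioi (0:ℝ), 
      ENNReal.ofReal (r ^ (Module.finrank ℝ E - 1)) * F (r • (θ : E))) ∂ν.toSphere := by
  set d := Module.finrank ℝ E - 1 with hd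
  have h2 := ν.measurePreserving_homeomorphUnitSphereProd
  calc ∫⁻ x, F x ∂ν = ∫⁻ x : ({(0)}ᶜ : Set E), F x ∂(ν.comap (↑)) := by
        rw [lintegral_subtype_comap (measurableSet_singleton _).compl F, restrict_compl_singleton]
    _ = ∫⁻ q, F (q.2.1 • (q.1 : E)) ∂(ν.toSphere.prod (.volumeIoiPow d)) := by
        rw [← h2.lintegral_comp_emb (Homeomorph.measurableEmbedding _)]
        refine lintegral_congr fun x => ?_
        congr 1
        have hx : (x : E) ≠ 0 := x.2
        simp [smul_smul, hx]
    _ = ∫⁻ θ, ∫⁻ r, F (r.1 • (θ : E)) ∂(.volumeIoiPow d) ∂ν.toSphere := by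
        rw [lintegral_prod]
        apply Measurable.aemeasurable
        fun_prop
    _ = _ := by
        refine lintegral_congr fun θ => ?_
        rw [Measure.volumeIoiPow, lintegral_withDensity_eq_lintegral_mul _ (by fun_prop) (by fun_prop)]
        exact lintegral_subtype_comap measurableSet_Ioi (fun r : ℝ => ENNReal.ofReal (r ^ d) * F (r • (θ : E)))

theorem polar_map [Nontrivial E] : ν = ((ν.toSphere.prod ((volume : Measure ℝ).restrict (Ioi 0))).withDensity
    (fun q => ENNReal.ofReal (q.2 ^ (Module.finrank ℝ E - 1)))).map (fun q => q.2 • (q.1 : E)) := by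
  refine Measure.ext_of_lintegral _ fun F hF => ?_
  have hm : Measurable (fun q : sphere (0:E) 1 × ℝ => q.2 • (q.1 : E)) := by fun_prop
  rw [lintegral_map hF hm, lintegral_withDensity_eq_lintegral_mul _ (by fun_prop) (by fun_prop),
    lintegral_prod _ (by apply Measurable.aemeasurable; fun_prop), polar_lintegral ν hF]
  rfl

theorem polar_ae [Nontrivial E] {p : E → Prop} (hp : ∀ᵐ x ∂ν, p x) :
    ∀ᵐ q ∂(ν.toSphere.prod ((volume : Measure ℝ).restrict (Ioi 0))), p (q.2 • (q.1 : E)) := by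
  rw [polar_map ν] at hp
  have hm : Measurable (fun q : sphere (0:E) 1 × ℝ => q.2 • (q.1 : E)) := by fun_prop
  have h1 := ae_of_ae_map hm.aemeasurable hp
  rw [ae_withDensity_iff (by fun_prop)] at h1
  have : ∀ᵐ q ∂(ν.toSphere.prod ((volume : Measure ℝ).restrict (Ioi 0))), q.2 ∈ Ioi (0:ℝ) := by
    have h1 : ∀ᵐ r ∂((volume : Measure ℝ).restrict (Ioi 0)), r ∈ Ioi (0:ℝ) := ae_restrict_mem measurableSet_Ioi
    exact Measure.quasiMeasurePreserving_snd.ae h1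
  filter_upwards [h1, this] with q hq hq2
  refine hq ?_
  have : 0 < q.2 ^ (Module.finrank ℝ E - 1) := pow_pos hq2 _
  simpa using this

theorem polar_ae_left [Nontrivial E] {p : E → Prop} (hp : ∀ᵐ x ∂ν, p x) :
    ∀ᵐ (θ : sphere (0:E) 1) ∂ν.toSphere, ∀ᵐ r ∂(volume : Measure ℝ), 0 < r → p (r • (θ : E)) := by
  have h := Measure.ae_ae_of_ae_prod (polar_ae ν hp)
  filter_upwards [h] with θ hθ
  exact (ae_restrict_iff' measurableSet_Ioi).1 hθ

theorem polar_ae_right [Nontrivial E] {p : E → Prop} (hp : ∀ᵐ x ∂ν, p x) :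
    ∀ᵐ r ∂(volume : Measure ℝ), 0 < r → ∀ᵐ (θ : sphere (0:E) 1) ∂ν.toSphere, p (r • (θ : E)) := by
  have h0 := Measure.measurePreserving_swap (μ := (volume : Measure ℝ).restrict (Ioi 0)) (ν := ν.toSphere)
    |>.quasiMeasurePreserving.ae (polar_ae ν hp)
  have h := Measure.ae_ae_of_ae_prod h0
  exact (ae_restrict_iff' measurableSet_Ioi).1 h

theorem polar_integral_left [Nontrivial E] {F : E → ℝ} {R C : ℝ} (hR : 0 ≤ R) (hF : Measurable F)
    (hb : ∀ x ∈ closedBall (0:E) R, |F x| ≤ C) :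
    ∫ x in closedBall (0:E) R, F x ∂ν = ∫ θ, (∫ r in (0:ℝ)..R, 
      r ^ (Module.finrank ℝ E - 1) * F (r • (θ : E))) ∂ν.toSphere := by
  set d := Module.finrank ℝ E - 1 with hd
  have hm : Measurable (fun q : sphere (0:E) 1 × ℝ => q.2 • (q.1 : E)) := by fun_prop
  have hind : Measurable ((closedBall (0:E) R).indicator F) := hF.indicator measurableSet_closedBall
  have hC : ∀ x, |(closedBall (0:E) R).indicator F x| ≤ |C| := by
    intro x
    by_cases hx : x ∈ closedBall (0:E) R
    · rw [indicator_of_mem hx]; exact (hb x hx).trans (le_abs_self C)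
    · rw [indicator_of_notMem hx]; simp
  have key : ∀ (θ : sphere (0:E) 1) (r : ℝ), 0 < r → 
      (closedBall (0:E) R).indicator F (r • (θ : E)) = (Iic R).indicator (fun r => F (r • (θ:E))) r := by
    intro θ r hr
    have hθ : ‖(θ : E)‖ = 1 := by simp
    simp only [indicator, mem_closedBall_zero_iff, norm_smul, hθ, mem_Iic, norm_eq_abs, abs_of_pos hr, mul_one]
  have e1 : ∀ θ : sphere (0:E) 1, (∫ r in Ioi (0:ℝ), r ^ d * (closedBall (0:E) R).indicator F (r • (θ : E)))
     = ∫ r in (0:ℝ)..R, r ^ d * F (r • (θ : E)) := by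
    intro θ
    rw [intervalIntegral.integral_of_le hR, ← Ioi_inter_Iic, ← setIntegral_indicator measurableSet_Iic]
    refine setIntegral_congr_fun measurableSet_Ioi fun r hr => ?_
    show r ^ d * (closedBall (0:E) R).indicator F (r • (θ : E)) = _
    rw [key θ r hr]
    simp only [indicator]
    split_ifs <;> simp
  rw [← integral_indicator measurableSet_closedBall]
  simp_rw [← e1]
  conv_lhs => rw [polar_map ν]
  rw [integral_map hm.aemeasurable hind.aestronglyMeasurable]
  have e2 : ∫ q, (closedBall (0:E) R).indicator F (q.2 • (q.1 : E)) ∂((ν.toSphere.prod ((volume : Measure ℝ).restrict (Ioi 0))).withDensity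
    (fun q => ENNReal.ofReal (q.2 ^ d))) = ∫ q, q.2 ^ d * (closedBall (0:E) R).indicator F (q.2 • (q.1 : E)) ∂(ν.toSphere.prod ((volume : Measure ℝ).restrict (Ioi 0))) := by
    have : (fun q : sphere (0:E) 1 × ℝ => ENNReal.ofReal (q.2 ^ d)) = fun q => ((Real.toNNReal (q.2^d) : NNReal) : ENNReal) := rfl
    rw [this, integral_withDensity_eq_integral_smul (by fun_prop)]
    have h3 : ∀ᵐ q ∂(ν.toSphere.prod ((volume : Measure ℝ).restrict (Ioi 0))), q.2 ∈ Ioi (0:ℝ) := by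
      have h1 : ∀ᵐ r ∂((volume : Measure ℝ).restrict (Ioi 0)), r ∈ Ioi (0:ℝ) := ae_restrict_mem measurableSet_Ioi
      exact Measure.quasiMeasurePreserving_snd.ae h1
    refine integral_congr_ae ?_
    filter_upwards [h3] with q hq
    rw [NNReal.smul_def, Real.coe_toNNReal _ (pow_nonneg (le_of_lt hq) _), smul_eq_mul]
  rw [e2, integral_prod]
  have hmk : Measurable (fun q : sphere (0:E) 1 × ℝ => q.2 ^ d * (closedBall (0:E) R).indicator F (q.2 • (q.1 : E))) := by
    have := hind.comp hm
    exact (measurable_snd.pow_const d).mul this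
  have h4 : Integrable ((univ ×ˢ Ioc 0 R).indicator (fun q : sphere (0:E) 1 × ℝ => q.2 ^ d * (closedBall (0:E) R).indicator F (q.2 • (q.1 : E)))) (ν.toSphere.prod ((volume : Measure ℝ).restrict (Ioi 0))) := by
    rw [integrable_indicator_iff (MeasurableSet.univ.prod measurableSet_Ioc), IntegrableOn, 
      ← Measure.prod_restrict, Measure.restrict_univ, Measure.restrict_restrict measurableSet_Ioc, 
      inter_eq_left.2 Ioc_subset_Ioi_self]
    refine aux_integrable_prod ν (C := R ^ d * |C|) hmk ?_
    intro θ r hr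
    rw [abs_mul, abs_of_nonneg (pow_nonneg hr.1.le d)]
    exact mul_le_mul (pow_le_pow_left₀ hr.1.le hr.2 d) (hC _) (abs_nonneg _) (pow_nonneg hR _)
  refine h4.congr ?_
  have h3 : ∀ᵐ q ∂(ν.toSphere.prod ((volume : Measure ℝ).restrict (Ioi 0))), q.2 ∈ Ioi (0:ℝ) := by
      have h1 : ∀ᵐ r ∂((volume : Measure ℝ).restrict (Ioi 0)), r ∈ Ioi (0:ℝ) := ae_restrict_mem measurableSet_Ioi
      exact Measure.quasiMeasurePreserving_snd.ae h1
  filter_upwards [h3] with q hq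
  by_cases hqR : q.2 ≤ R
  · rw [indicator_of_mem]
    exact ⟨mem_univ _, hq, hqR⟩
  · rw [indicator_of_notMem (fun h => hqR h.2.2), key q.1 q.2 hq]
    simp [hqR]

theorem polar_integral [Nontrivial E] {F : E → ℝ} {R C : ℝ} (hR : 0 ≤ R) (hF : Measurable F)
    (hb : ∀ x ∈ closedBall (0:E) R, |F x| ≤ C) :
    ∫ x in closedBall (0:E) R, F x ∂ν = ∫ r in (0:ℝ)..R, 
      r ^ (Module.finrank ℝ E - 1) * (∫ θ, F (r • (θ : E)) ∂ν.toSphere) := by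
  rw [polar_integral_left ν hR hF hb]
  have := aux_swap ν (k := fun q => q.2 ^ (Module.finrank ℝ E - 1) * F (q.2 • (q.1 : E))) (C := R ^ (Module.finrank ℝ E - 1) * |C|) hR 
    (by 
      have hm : Measurable (fun q : sphere (0:E) 1 × ℝ => q.2 • (q.1 : E)) := by fun_prop
      exact (measurable_snd.pow_const _).mul (hF.comp hm)) ?_
  · simp only [] at this
    rw [this]
    simp_rw [integral_const_mul]
  · intro θ r hr
    rw [abs_mul, abs_of_nonneg (pow_nonneg hr.1.le _)]
    refine mul_le_mul (pow_le_pow_left₀ hr.1.le hr.2 _) ((hb _ ?_).trans (le_abs_self C)) (abs_nonneg _) (pow_nonneg hR _)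
    have hθ : ‖(θ : E)‖ = 1 := by simp
    simp only [mem_closedBall_zero_iff, norm_smul, hθ, norm_eq_abs, abs_of_pos hr.1, mul_one]
    exact hr.2
end Polar


section Rays
variable {E : Type*} [NormedAddCommGroup E] [InnerProductSpace ℝ E] [FiniteDimensional ℝ E]
  [CompleteSpace E] [MeasurableSpace E] [BorelSpace E] (ν : Measure E) [ν.IsAddHaarMeasure]

theorem measurable_gradient' (f : E → ℝ) : Measurable (gradient f) := by
  unfold gradient
  exact (InnerProductSpace.toDual ℝ E).symm.continuous.measurable.comp (measurable_fderiv ℝ f)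

theorem norm_gradient_le_lip {f : E → ℝ} {K : NNReal} (hf : LipschitzWith K f) (x : E) :
    ‖gradient f x‖ ≤ K := by
  unfold gradient
  rw [LinearIsometryEquiv.norm_map]
  exact norm_fderiv_le_of_lipschitz ℝ hf

theorem hasDerivAt_ray {f : E → ℝ} {θ : E} {r : ℝ} (h : DifferentiableAt ℝ f (r • θ)) :
    HasDerivAt (fun s : ℝ => f (s • θ)) (inner ℝ (gradient f (r • θ)) θ) r := by
  have h1 := h.hasFDerivAt
  have h2 : HasDerivAt (fun s : ℝ => s • θ) θ r := by
    simpa using (hasDerivAt_id r).smul_const θ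
  have h3 := h1.comp_hasDerivAt r h2
  have h4 : inner ℝ (gradient f (r • θ)) θ = fderiv ℝ f (r • θ) θ := by
    unfold gradient
    rw [InnerProductSpace.toDual_symm_apply]
  rw [h4]
  exact h3

theorem ftc_ac {φ φ' : ℝ → ℝ} {a b : ℝ} (hab : a ≤ b) (hφ : AbsolutelyContinuousOnInterval φ a b)
    (hd : ∀ᵐ r ∂(volume : Measure ℝ), r ∈ Ioc a b → HasDerivAt φ (φ' r) r) :
    ∫ r in a..b, φ' r = φ b - φ a := by
  rw [← hφ.integral_deriv_eq_sub]
  refine intervalIntegral.integral_congr_ae ?_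
  filter_upwards [hd] with r hr hr2
  rw [uIoc_of_le hab] at hr2
  exact (hr hr2).deriv.symm

theorem lip_ray {f : E → ℝ} {K : NNReal} (hf : LipschitzWith K f) (θ : sphere (0:E) 1) :
    LipschitzWith K (fun s : ℝ => f (s • (θ : E))) := by
  refine LipschitzWith.of_dist_le_mul fun s t => ?_
  have hθ : ‖(θ : E)‖ = 1 := by simp
  refine (hf.dist_le_mul _ _).trans_eq ?_
  rw [dist_eq_norm, ← sub_smul, norm_smul, hθ, mul_one, dist_eq_norm]

theorem ray_ac [Nontrivial E] {f : E → ℝ} {K : NNReal} (hf : LipschitzWith K f) {c c' : ℝ → ℝ} {a b : ℝ}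
    (ha : 0 ≤ a) (hab : a ≤ b) (hc : ContDiffOn ℝ 1 c (uIcc a b))
    (hc' : ∀ r ∈ Ioc a b, HasDerivAt c (c' r) r) :
    ∀ᵐ (θ : sphere (0:E) 1) ∂ν.toSphere,
      AbsolutelyContinuousOnInterval (fun r => c r * f (r • (θ : E))) a b ∧
      ∀ᵐ r ∂(volume : Measure ℝ), r ∈ Ioc a b → HasDerivAt (fun r => c r * f (r • (θ : E)))
        (c' r * f (r • (θ : E)) + c r * inner ℝ (gradient f (r • (θ : E))) (θ : E)) r := by
  filter_upwards [polar_ae_left ν (hf.ae_differentiableAt (μ := ν))] with θ hθ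
  refine ⟨?_, ?_⟩
  · exact (hc.absolutelyContinuousOnInterval).fun_mul
      ((lip_ray hf θ).lipschitzOnWith (s := uIcc a b)).absolutelyContinuousOnInterval
  · filter_upwards [hθ] with r hr hr2
    exact (hc' r hr2).mul (hasDerivAt_ray (hr (ha.trans_lt hr2.1)))

end Rays


section Core
variable {E : Type*} [NormedAddCommGroup E] [InnerProductSpace ℝ E] [FiniteDimensional ℝ E]
  [CompleteSpace E] [MeasurableSpace E] [BorelSpace E]

/-- the localized setting, centred at the origin -/
structure Core (ν : Measure E) (f D g : E → ℝ) (K : NNReal) (ρ M γs C1 : ℝ) : Prop where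
  lip : LipschitzWith K f
  f0 : f 0 = 0
  nn : ∀ x ∈ closedBall (0:E) ρ, 0 ≤ f x
  rho_pos : 0 < ρ
  rho_le : ρ ≤ 1
  Dm : Measurable D
  gm : Measurable g
  D_nn : ∀ x, 0 ≤ D x
  D_le : ∀ x, D x ≤ M
  gs_pos : 0 < γs
  g_ge : ∀ x ∈ closedBall (0:E) ρ, γs ≤ g x
  g_le : ∀ x ∈ closedBall (0:E) ρ, g x ≤ 1
  D_lip : ∀ x ∈ closedBall (0:E) ρ, |D x - D 0| ≤ C1 * ‖x‖
  g_lip : ∀ x ∈ closedBall (0:E) ρ, |g x - g 0| ≤ C1 * ‖x‖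
  isMin : ∀ R ∈ Ioc 0 ρ, ∀ v : E → ℝ, (∃ K', LipschitzWith K' v) →
    (∀ x, x ∉ closedBall (0:E) R → v x = f x) → (∀ x ∈ closedBall (0:E) R, 0 ≤ v x) →
    ∫ x in closedBall (0:E) R, ((1:ℝ)/2 * ‖gradient f x‖ ^ 2 + D x * f x ^ g x) ∂ν ≤
    ∫ x in closedBall (0:E) R, ((1:ℝ)/2 * ‖gradient v x‖ ^ 2 + D x * v x ^ g x) ∂ν

variable {ν : Measure E} [ν.IsAddHaarMeasure] {f D g : E → ℝ} {K : NNReal} {ρ M γs C1 : ℝ}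

theorem bdd_integrableOn {F : E → ℝ} {R C : ℝ} (hF : Measurable F)
    (hb : ∀ x ∈ closedBall (0:E) R, |F x| ≤ C) : IntegrableOn F (closedBall (0:E) R) ν := by
  refine Integrable.mono' (g := fun _ => C) ?_ hF.aestronglyMeasurable ?_
  · exact (integrableOn_const (isCompact_closedBall (0:E) R).measure_lt_top.ne)
  · filter_upwards [ae_restrict_mem measurableSet_closedBall] with x hx
    exact hb x hx

theorem rpow_bdd {w p B : ℝ} (hw : 0 ≤ w) (hB : w ≤ B) (hp0 : 0 ≤ p) (hp : p ≤ 1) : w ^ p ≤ 1 + B := by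
  rcases le_total w 1 with h | h
  · have := rpow_le_one hw h hp0
    linarith
  · have : w ^ p ≤ w ^ (1:ℝ) := rpow_le_rpow_of_exponent_le h hp
    rw [rpow_one] at this
    linarith

theorem Core.energy_int (h : Core ν f D g K ρ M γs C1) {v : E → ℝ} {K' : NNReal} (hv : LipschitzWith K' v) {R B : ℝ}
    (hR : R ≤ ρ) (hv0 : ∀ x ∈ closedBall (0:E) R, 0 ≤ v x) (hvB : ∀ x ∈ closedBall (0:E) R, v x ≤ B) :
    IntegrableOn (fun x => (1:ℝ)/2 * ‖gradient v x‖ ^ 2 + D x * v x ^ g x) (closedBall (0:E) R) ν := by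
  have hm : Measurable (fun x => (1:ℝ)/2 * ‖gradient v x‖ ^ 2 + D x * v x ^ g x) := by
    have h1 := measurable_gradient' v
    have h2 := hv.continuous.measurable
    have h3 := h.Dm
    have h4 := h.gm
    fun_prop
  refine bdd_integrableOn (C := (1:ℝ)/2 * K' ^ 2 + M * (1 + B)) hm fun x hx => ?_
  have hx' : x ∈ closedBall (0:E) ρ := closedBall_subset_closedBall hR hx
  have h1 := norm_gradient_le_lip hv x
  have h2 := rpow_bdd (hv0 x hx) (hvB x hx) (h.gs_pos.le.trans (h.g_ge x hx')) (h.g_le x hx')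
  have h3 := rpow_nonneg (hv0 x hx) (g x)
  have h4 := h.D_nn x
  rw [abs_of_nonneg (by positivity)]
  have h5 : ‖gradient v x‖ ^ 2 ≤ (K':ℝ)^2 := pow_le_pow_left₀ (norm_nonneg _) h1 2
  have h6 : D x * v x ^ g x ≤ M * (1 + B) := mul_le_mul (h.D_le x) h2 h3 (h4.trans (h.D_le x))
  linarith

theorem Core.f_le (h : Core ν f D g K ρ M γs C1) (x : E) : |f x| ≤ K * ‖x‖ := by
  have := h.lip.dist_le_mul x 0
  simpa [h.f0, dist_eq_norm] using this

theorem hasFDerivAt_norm' {x : E} (hx : x ≠ 0) :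
    HasGradientAt (fun y : E => ‖y‖) (‖x‖⁻¹ • x) x := by
  have h1 : HasFDerivAt (fun y : E => ‖y‖ ^ 2) (2 • (innerSL ℝ x)) x := (hasStrictFDerivAt_norm_sq x).hasFDerivAt
  have h2 : HasFDerivAt (fun y : E => √(‖y‖ ^ 2)) _ x := h1.sqrt (by positivity)
  have h3 : (fun y : E => √(‖y‖ ^ 2)) = fun y => ‖y‖ := by
    ext y; exact sqrt_sq (norm_nonneg y)
  rw [h3] at h2
  rw [hasGradientAt_iff_hasFDerivAt]
  have e : (InnerProductSpace.toDual ℝ E) (‖x‖⁻¹ • x) = (1 / (2 * √(‖x‖ ^ 2))) • (2 • (innerSL ℝ x)) := by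
    have hx' : ‖x‖ ≠ 0 := by simpa using hx
    ext y
    rw [sqrt_sq (norm_nonneg x), InnerProductSpace.toDual_apply_apply, real_inner_smul_left]
    simp only [ContinuousLinearMap.smul_apply, innerSL_apply_apply, smul_eq_mul, nsmul_eq_mul]
    push_cast
    field_simp
  rw [e]
  exact h2

/-- growth, step 1 -/
theorem Core.growth1 (h : Core ν f D g K ρ M γs C1) {R ε : ℝ} (hR : R ∈ Ioc 0 ρ) (hε : 0 < ε) (hε1 : ε * R ≤ 1) :
    ∫ x in closedBall (0:E) R, inner ℝ (gradient f x) (‖x‖⁻¹ • x) ∂ν ≤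
      ν.real (closedBall (0:E) R) * (ε / 2 + M * (ε * R) ^ γs / ε) := by
  set v : E → ℝ := fun x => f x + ε * max (R - ‖x‖) 0 with hvdef
  have hM : 0 ≤ M := (h.D_nn 0).trans (h.D_le 0)
  have hvlip : LipschitzWith (K + (Real.toNNReal ε)) v := by
    refine LipschitzWith.of_dist_le_mul fun x y => ?_
    have h1 := h.lip.dist_le_mul x y
    have h2 : |max (R - ‖x‖) 0 - max (R - ‖y‖) 0| ≤ ‖x - y‖ := by
      refine (abs_max_sub_max_le_abs _ _ _).trans ?_
      have := abs_norm_sub_norm_le y x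
      rw [norm_sub_rev y x] at this
      have e : R - ‖x‖ - (R - ‖y‖) = ‖y‖ - ‖x‖ := by ring
      rw [e]; exact this
    rw [Real.dist_eq] at h1 ⊢
    rw [dist_eq_norm] at h1 ⊢
    push_cast
    rw [Real.coe_toNNReal _ hε.le]
    calc |v x - v y| = |(f x - f y) + ε * (max (R - ‖x‖) 0 - max (R - ‖y‖) 0)| := by
          simp only [hvdef]; congr 1; ring
      _ ≤ |f x - f y| + |ε * (max (R - ‖x‖) 0 - max (R - ‖y‖) 0)| := abs_add_le _ _
      _ ≤ K * ‖x - y‖ + ε * ‖x - y‖ := by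
          rw [abs_mul, abs_of_pos hε]
          gcongr
      _ = _ := by ring
  have hsub : closedBall (0:E) R ⊆ closedBall (0:E) ρ := closedBall_subset_closedBall hR.2
  have hv0 : ∀ x ∈ closedBall (0:E) R, 0 ≤ v x := fun x hx =>
    add_nonneg (h.nn x (hsub hx)) (mul_nonneg hε.le (le_max_right _ _))
  have hmin := h.isMin R hR v ⟨_, hvlip⟩ (by
    intro x hx
    simp only [mem_closedBall_zero_iff, not_le] at hx
    simp only [hvdef]
    rw [max_eq_right (by linarith)]; simp) hv0
  have hfB : ∀ x ∈ closedBall (0:E) R, f x ≤ K * R := fun x hx => by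
    have := (le_abs_self _).trans (h.f_le x)
    rw [mem_closedBall_zero_iff] at hx
    exact this.trans (by gcongr)
  have hvB : ∀ x ∈ closedBall (0:E) R, v x ≤ K * R + ε * R := fun x hx => by
    have := hfB x hx
    have h2 : max (R - ‖x‖) 0 ≤ R := max_le (by linarith [norm_nonneg x]) hR.1.le
    simp only [hvdef]
    gcongr
  have hIf := h.energy_int (ν := ν) h.lip hR.2 (fun x hx => h.nn x (hsub hx)) hfB
  have hIv := h.energy_int (ν := ν) hvlip hR.2 hv0 hvB
  have hgm : Measurable (fun x => inner ℝ (gradient f x) (‖x‖⁻¹ • x)) := by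
    have h1 := measurable_gradient' f
    exact h1.inner (by fun_prop)
  have hIg : IntegrableOn (fun x => inner ℝ (gradient f x) (‖x‖⁻¹ • x)) (closedBall (0:E) R) ν := by
    refine bdd_integrableOn (C := K) hgm fun x _ => ?_
    refine (abs_real_inner_le_norm _ _).trans ?_
    have h1 := norm_gradient_le_lip h.lip x
    have h2 : ‖(‖x‖⁻¹ • x)‖ ≤ 1 := by
      rw [norm_smul, norm_inv, norm_norm]
      exact inv_mul_le_one
    calc _ ≤ (K:ℝ) * 1 := mul_le_mul h1 h2 (norm_nonneg _) K.2
      _ = K := mul_one _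
  have hle : ∫ x in closedBall (0:E) R, ((1:ℝ)/2 * ‖gradient v x‖ ^ 2 + D x * v x ^ g x) ∂ν ≤
      ∫ x in closedBall (0:E) R, (((1:ℝ)/2 * ‖gradient f x‖ ^ 2 + D x * f x ^ g x) +
        (- ε * inner ℝ (gradient f x) (‖x‖⁻¹ • x) + (ε ^ 2 / 2 + M * (ε * R) ^ γs))) ∂ν := by
    have hconst : IntegrableOn (fun _ : E => (ε ^ 2 / 2 + M * (ε * R) ^ γs)) (closedBall (0:E) R) ν := 
      integrableOn_const (isCompact_closedBall (0:E) R).measure_lt_top.ne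
    refine integral_mono_ae hIv (hIf.add ((hIg.const_mul (-ε)).add hconst)) ?_
    have hs : ∀ᵐ x ∂ν, x ∉ sphere (0:E) R := by
      have := Measure.addHaar_sphere_of_ne_zero ν (0:E) hR.1.ne'
      exact measure_eq_zero_iff_ae_notMem.1 this
    have hz : ∀ᵐ x ∂ν, x ∉ sphere (0:E) 0 ∨ ∀ x : E, x = 0 := by
      by_cases hE : Nontrivial E
      · have := Measure.addHaar_sphere ν (0:E) 0
        filter_upwards [measure_eq_zero_iff_ae_notMem.1 this] with x hx
        exact Or.inl hx
      · rw [not_nontrivial_iff_subsingleton] at hE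
        exact Filter.Eventually.of_forall fun x => Or.inr fun y => Subsingleton.elim _ _
    filter_upwards [ae_restrict_mem measurableSet_closedBall, ae_restrict_of_ae hs, ae_restrict_of_ae hz,
      ae_restrict_of_ae (h.lip.ae_differentiableAt (μ := ν))] with x hx hxs hxz hxd
    have hxρ := hsub hx
    rw [mem_closedBall_zero_iff] at hx
    rw [mem_sphere_zero_iff_norm] at hxs
    have hlt : ‖x‖ < R := lt_of_le_of_ne hx hxs
    have hpot : D x * v x ^ g x ≤ D x * f x ^ g x + M * (ε * R) ^ γs := by
      have hφ0 : 0 ≤ ε * max (R - ‖x‖) 0 := mul_nonneg hε.le (le_max_right _ _)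
      have hφR : ε * max (R - ‖x‖) 0 ≤ ε * R := 
        mul_le_mul_of_nonneg_left (max_le (by linarith [norm_nonneg x]) hR.1.le) hε.le
      have hg0 := h.gs_pos.trans_le (h.g_ge x hxρ)
      have h1 : v x ^ g x ≤ f x ^ g x + (ε * max (R - ‖x‖) 0) ^ g x := 
        Real.rpow_add_le_add_rpow (h.nn x hxρ) hφ0 hg0.le (h.g_le x hxρ)
      have h2 : (ε * max (R - ‖x‖) 0) ^ g x ≤ (ε * R) ^ γs := 
        (rpow_le_rpow hφ0 hφR hg0.le).trans 
          (rpow_le_rpow_of_exponent_ge (mul_pos hε hR.1) hε1 (h.g_ge x hxρ))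
      calc D x * v x ^ g x ≤ D x * (f x ^ g x + (ε * R) ^ γs) := 
            mul_le_mul_of_nonneg_left (by linarith) (h.D_nn x)
        _ = D x * f x ^ g x + D x * (ε * R) ^ γs := by ring
        _ ≤ _ := by
            have := mul_le_mul_of_nonneg_right (h.D_le x) (rpow_nonneg (mul_pos hε hR.1).le γs)
            linarith
    have hgrad : ‖gradient v x‖ ^ 2 ≤ ‖gradient f x‖ ^ 2 - 2 * ε * inner ℝ (gradient f x) (‖x‖⁻¹ • x) + ε ^ 2 := by
      rcases hxz with hxz | hxz
      · have hx0 : x ≠ 0 := by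
          rw [mem_sphere_zero_iff_norm] at hxz
          simpa using hxz
        have hg1 : HasGradientAt v (gradient f x + ε • (-(‖x‖⁻¹ • x))) x := by
          have e1 : HasGradientAt (fun y => f y + ε * (R - ‖y‖)) (gradient f x + ε • (-(‖x‖⁻¹ • x))) x := by
            have a1 := hxd.hasGradientAt.hasFDerivAt
            have a2 := (hasFDerivAt_norm' hx0).hasFDerivAt
            rw [hasGradientAt_iff_hasFDerivAt]
            have a3 := a1.add ((a2.const_sub R).const_mul ε)
            have e : (InnerProductSpace.toDual ℝ E) (gradient f x + ε • (-(‖x‖⁻¹ • x))) =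
              (InnerProductSpace.toDual ℝ E) (gradient f x) + ε • (-(InnerProductSpace.toDual ℝ E) (‖x‖⁻¹ • x)) := by
              ext y
              simp only [InnerProductSpace.toDual_apply_apply, ContinuousLinearMap.add_apply, ContinuousLinearMap.smul_apply,
                ContinuousLinearMap.neg_apply, inner_add_left, real_inner_smul_left, inner_neg_left, smul_eq_mul]
            rw [e]
            exact a3
          refine e1.congr_of_eventuallyEq ?_
          have : ∀ᶠ y in nhds x, ‖y‖ < R := (continuous_norm.tendsto x).eventually (gt_mem_nhds hlt)
          filter_upwards [this] with y hy
          simp only [hvdef]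
          rw [max_eq_left (by linarith)]
        rw [hg1.gradient, norm_add_sq_real, inner_smul_right, inner_neg_right, norm_smul, norm_neg, norm_smul,
          norm_inv, norm_norm, inv_mul_cancel₀ (by simpa using hx0), norm_eq_abs, abs_of_pos hε]
        apply le_of_eq; ring
      · have e1 : gradient v x = 0 := hxz _
        have e2 : gradient f x = 0 := hxz _
        rw [e1, e2]
        simp
        positivity
    linarith
  have hconst : IntegrableOn (fun _ : E => (ε ^ 2 / 2 + M * (ε * R) ^ γs)) (closedBall (0:E) R) ν := 
      integrableOn_const (isCompact_closedBall (0:E) R).measure_lt_top.ne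
  have hI2 : IntegrableOn (fun x => - ε * inner ℝ (gradient f x) (‖x‖⁻¹ • x) + (ε ^ 2 / 2 + M * (ε * R) ^ γs))
      (closedBall (0:E) R) ν := (hIg.const_mul (-ε)).add hconst
  rw [integral_add hIf hI2, integral_add (hIg.const_mul (-ε)) hconst, 
    integral_const_mul, setIntegral_const, smul_eq_mul] at hle
  have h9 : ε * ∫ x in closedBall (0:E) R, inner ℝ (gradient f x) (‖x‖⁻¹ • x) ∂ν ≤ 
      ν.real (closedBall (0:E) R) * (ε ^ 2 / 2 + M * (ε * R) ^ γs) := by linarith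
  rw [← mul_le_mul_iff_of_pos_left hε]
  refine h9.trans_eq ?_
  field_simp
end Core


theorem growth_iter {U : ℝ → ℝ} (hU : Continuous U) {k : ℕ} (hk : 1 ≤ k) {A C2 α ρ : ℝ} (hA : 0 ≤ A) (hC2 : 0 ≤ C2)
    (hα : 0 < α) (h0 : ∀ r ∈ Icc 0 ρ, U r ≤ A * r)
    (hi : ∀ R ∈ Ioc 0 ρ, R ^ k * U R ≤ (∫ r in (0:ℝ)..R, (k * r ^ (k-1)) * U r) + C2 * (R ^ (k+1) * R ^ α)) :
    ∀ r ∈ Icc 0 ρ, U r ≤ C2 * (k+1) * (r * r ^ α) := by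
  obtain ⟨l, rfl⟩ : ∃ l, k = l + 1 := ⟨k - 1, by omega⟩
  simp only [Nat.add_sub_cancel] at hi
  set C' : ℝ := C2 * (((l + 1 : ℕ) : ℝ) + 1) with hC'
  have hC'0 : 0 ≤ C' := by positivity
  set q : ℝ := ((l + 1 : ℕ) : ℝ) / (((l + 1 : ℕ) : ℝ) + 1) with hq
  have hq0 : 0 ≤ q := by positivity
  have hq1 : q < 1 := by rw [hq, div_lt_one (by positivity)]; linarith
  have hCq : C' * q + C2 = C' := by
    rw [hC', hq]; field_simp
  have key : ∀ j : ℕ, ∀ r ∈ Icc 0 ρ, U r ≤ A * q ^ j * r + C' * (r * r ^ α) := by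
    intro j
    induction j with
    | zero =>
      intro r hr
      have h1 := h0 r hr
      have : 0 ≤ C' * (r * r ^ α) := mul_nonneg hC'0 (mul_nonneg hr.1 (rpow_nonneg hr.1 _))
      simpa using h1.trans (by linarith)
    | succ j ih =>
      intro R hR
      rcases hR.1.eq_or_lt with h | h
      · subst h
        have := h0 0 hR
        simpa using this
      · have h1 := hi R ⟨h, hR.2⟩
        have h2 : (∫ r in (0:ℝ)..R, (((l+1:ℕ):ℝ) * r ^ l) * U r) ≤ 
            ∫ r in (0:ℝ)..R, (((l+1:ℕ):ℝ) * (A * q ^ j + C' * R ^ α)) * r ^ (l+1) := by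
          refine intervalIntegral.integral_mono_on h.le ((by fun_prop : Continuous _).intervalIntegrable _ _) 
            ((by fun_prop : Continuous _).intervalIntegrable _ _) fun r hr => ?_
          have h3 := ih r ⟨hr.1, hr.2.trans hR.2⟩
          have h4 : r ^ α ≤ R ^ α := rpow_le_rpow hr.1 hr.2 hα.le
          have h5 : U r ≤ (A * q ^ j + C' * R ^ α) * r := by
            have : C' * (r * r ^ α) ≤ C' * (r * R ^ α) := by
              have := hr.1
              gcongr
            linarith
          calc _ ≤ (((l+1:ℕ):ℝ) * r ^ l) * ((A * q ^ j + C' * R ^ α) * r) := by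
                have := hr.1
                gcongr
            _ = _ := by rw [pow_succ]; ring
        rw [intervalIntegral.integral_const_mul, integral_pow] at h2
        have h3 : R ^ (l+1) * U R ≤ R ^ (l+1) * (A * q ^ (j+1) * R + C' * (R * R ^ α)) := by
          refine (h1.trans (add_le_add_left h2 _)).trans_eq ?_
          have e : ((l + 1 : ℕ) : ℝ) * (A * q ^ j + C' * R ^ α) * ((R ^ (l + 1 + 1) - 0 ^ (l + 1 + 1)) / (((l + 1:ℕ):ℝ) + 1)) =
            q * (A * q ^ j + C' * R ^ α) * R ^ (l+2) := by
            rw [hq]; simp; ring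
          rw [e]
          have e2 : C' * (R * R ^ α) = (C' * q + C2) * (R * R ^ α) := by rw [hCq]
          rw [e2]
          ring
        exact le_of_mul_le_mul_left h3 (by positivity)
  intro r hr
  have ht : Filter.Tendsto (fun j : ℕ => A * q ^ j * r + C' * (r * r ^ α)) Filter.atTop (nhds (A * 0 * r + C' * (r * r ^ α))) := by
    refine Filter.Tendsto.add_const _ (Filter.Tendsto.mul_const _ (Filter.Tendsto.const_mul _ ?_))
    exact tendsto_pow_atTop_nhds_zero_of_lt_one hq0 hq1
  have := ge_of_tendsto' ht (fun j => key j r hr)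
  simpa using this

section Core2
variable {E : Type*} [NormedAddCommGroup E] [InnerProductSpace ℝ E] [FiniteDimensional ℝ E]
  [CompleteSpace E] [MeasurableSpace E] [BorelSpace E]
variable {ν : Measure E} [ν.IsAddHaarMeasure] {f D g : E → ℝ} {K : NNReal} {ρ M γs C1 : ℝ}

theorem measurable_polar : Measurable (fun q : sphere (0:E) 1 × ℝ => q.2 • (q.1 : E)) := by fun_prop

theorem continuous_sphere_integral {F : E → ℝ} (hF : Continuous F) :
    Continuous (fun r : ℝ => ∫ θ : sphere (0:E) 1, F (r • (θ : E)) ∂ν.toSphere) := by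
  have h := continuous_parametric_integral_of_continuous (μ := ν.toSphere) (s := (univ : Set (sphere (0:E) 1)))
    (f := fun (r : ℝ) (θ : sphere (0:E) 1) => F (r • (θ : E))) (by fun_prop) isCompact_univ
  simpa using h

theorem integrable_sphere_cont {F : sphere (0:E) 1 → ℝ} (hF : Continuous F) : Integrable F ν.toSphere := by
  have := hF.continuousOn.integrableOn_compact (μ := ν.toSphere) (isCompact_univ (X := sphere (0:E) 1))
  simpa using this

theorem norm_smul_sphere {r : ℝ} (hr : 0 ≤ r) (θ : sphere (0:E) 1) : ‖r • (θ : E)‖ = r := by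
  rw [norm_smul, norm_eq_of_mem_sphere, mul_one, norm_eq_abs, abs_of_nonneg hr]

theorem Core.growth2eq [Nontrivial E] (h : Core ν f D g K ρ M γs C1) {R : ℝ} (hR : 0 < R) (hd : 2 ≤ Module.finrank ℝ E) :
    ∫ x in closedBall (0:E) R, inner ℝ (gradient f x) (‖x‖⁻¹ • x) ∂ν = 
      R ^ (Module.finrank ℝ E - 1) * (∫ θ : sphere (0:E) 1, f (R • (θ : E)) ∂ν.toSphere) - 
      ∫ r in (0:ℝ)..R, ((Module.finrank ℝ E - 1 : ℕ) * r ^ (Module.finrank ℝ E - 1 - 1)) * 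
        ∫ θ : sphere (0:E) 1, f (r • (θ : E)) ∂ν.toSphere := by
  set k := Module.finrank ℝ E - 1 with hk
  have hk1 : k ≠ 0 := by omega
  have hgm : Measurable (fun x => inner ℝ (gradient f x) (‖x‖⁻¹ • x)) :=
    (measurable_gradient' f).inner (by fun_prop)
  have hgb : ∀ x : E, |inner ℝ (gradient f x) (‖x‖⁻¹ • x)| ≤ K := fun x => by
    refine (abs_real_inner_le_norm _ _).trans ?_
    have h1 := norm_gradient_le_lip h.lip x
    have h2 : ‖(‖x‖⁻¹ • x)‖ ≤ 1 := by
      rw [norm_smul, norm_inv, norm_norm]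
      exact inv_mul_le_one
    calc _ ≤ (K:ℝ) * 1 := mul_le_mul h1 h2 (norm_nonneg _) K.2
      _ = K := mul_one _
  rw [polar_integral_left ν hR.le hgm (fun x _ => hgb x)]
  have hfc := h.lip.continuous
  have hray := ray_ac ν h.lip (c := fun r => r ^ k) (c' := fun r => k * r ^ (k-1)) le_rfl hR.le 
    (by fun_prop) (fun r _ => hasDerivAt_pow k r)
  have e1 : ∀ᵐ θ : sphere (0:E) 1 ∂ν.toSphere, 
      (∫ r in (0:ℝ)..R, r ^ k * inner ℝ (gradient f (r • (θ:E))) (‖r • (θ:E)‖⁻¹ • (r • (θ:E)))) = 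
      R ^ k * f (R • (θ:E)) - ∫ r in (0:ℝ)..R, (k * r ^ (k-1)) * f (r • (θ:E)) := by
    filter_upwards [hray] with θ hθ
    have h1 := ftc_ac hR.le hθ.1 hθ.2
    have i1 : IntervalIntegrable (fun r : ℝ => (k * r ^ (k-1)) * f (r • (θ:E))) volume 0 R :=
      (by fun_prop : Continuous _).intervalIntegrable _ _
    have i2 : IntervalIntegrable (fun r : ℝ => r ^ k * inner ℝ (gradient f (r • (θ:E))) (θ:E)) volume 0 R := by
      refine (intervalIntegrable_const (c := R ^ k * (K:ℝ))).mono_fun' ?_ ?_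
      · refine Measurable.aestronglyMeasurable ?_
        have := measurable_gradient' f
        fun_prop
      · filter_upwards [ae_restrict_mem measurableSet_uIoc] with r hr
        rw [uIoc_of_le hR.le] at hr
        rw [norm_mul, norm_eq_abs, norm_eq_abs, abs_of_nonneg (pow_nonneg hr.1.le k)]
        have h3 := pow_le_pow_left₀ hr.1.le hr.2 k
        have h4 := abs_real_inner_le_norm (gradient f (r • (θ:E))) (θ:E)
        rw [norm_eq_of_mem_sphere, mul_one] at h4
        exact mul_le_mul h3 (h4.trans (norm_gradient_le_lip h.lip _)) (abs_nonneg _) (pow_nonneg hR.le k)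
    rw [intervalIntegral.integral_add i1 i2] at h1
    have e2 : (∫ r in (0:ℝ)..R, r ^ k * inner ℝ (gradient f (r • (θ:E))) (‖r • (θ:E)‖⁻¹ • (r • (θ:E)))) =
        ∫ r in (0:ℝ)..R, r ^ k * inner ℝ (gradient f (r • (θ:E))) (θ:E) := by
      refine intervalIntegral.integral_congr_ae (Filter.Eventually.of_forall fun r hr => ?_)
      rw [uIoc_of_le hR.le] at hr
      rw [norm_smul_sphere hr.1.le, smul_smul, inv_mul_cancel₀ hr.1.ne', one_smul]
    rw [e2]
    simp only [zero_pow hk1, zero_mul, sub_zero] at h1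
    linarith
  rw [integral_congr_ae e1]
  have hb : ∀ θ : sphere (0:E) 1, ∀ r ∈ Ioc 0 R, |(k * r ^ (k-1)) * f (r • (θ:E))| ≤ (k * R ^ (k-1)) * (K * R) := by
    intro θ r hr
    have h1 := h.f_le (r • (θ:E))
    rw [norm_smul_sphere hr.1.le] at h1
    have h2 := pow_le_pow_left₀ hr.1.le hr.2 (k-1)
    have h3 := hr.1.le
    rw [abs_mul, abs_of_nonneg (by positivity)]
    have h5 : (K:ℝ) * r ≤ K * R := by have := hr.2; gcongr
    have := h1.trans h5
    gcongr
  have hm : Measurable (fun q : sphere (0:E) 1 × ℝ => (k * q.2 ^ (k-1)) * f (q.2 • (q.1:E))) := by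
    fun_prop
  rw [integral_sub, integral_const_mul]
  · congr 1
    rw [aux_swap ν (k := fun q => (k * q.2 ^ (k-1)) * f (q.2 • (q.1:E))) hR.le hm hb]
    simp only [integral_const_mul]
  · exact (integrable_sphere_cont (by fun_prop)).const_mul _
  · exact aux_integrable_left ν (k := fun q => (k * q.2 ^ (k-1)) * f (q.2 • (q.1:E))) hR.le hm hb

theorem Core.growth3 [Nontrivial E] (h : Core ν f D g K ρ M γs C1) (hd : 2 ≤ Module.finrank ℝ E) :
    ∃ C' α : ℝ, 0 ≤ C' ∧ 0 < α ∧ ∀ r ∈ Icc 0 ρ, (∫ θ : sphere (0:E) 1, f (r • (θ : E)) ∂ν.toSphere) ≤ C' * (r * r ^ α) := by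
  set k := Module.finrank ℝ E - 1 with hk
  have hM : 0 ≤ M := (h.D_nn 0).trans (h.D_le 0)
  have hγ := h.gs_pos
  have hγ1 : γs ≤ 1 := (h.g_ge 0 (by simpa using h.rho_pos.le)).trans (h.g_le 0 (by simpa using h.rho_pos.le))
  set ω : ℝ := ν.real (ball (0:E) 1) with hω
  have hω0 : 0 ≤ ω := measureReal_nonneg
  refine ⟨ω * (1/2 + M) * (k+1), γs/2, by positivity, by positivity, ?_⟩
  have hfc := h.lip.continuous
  refine growth_iter (ρ := ρ) (k := k) (A := K * ν.toSphere.real univ) (continuous_sphere_integral hfc) (by omega) 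
    (mul_nonneg K.2 measureReal_nonneg) (by positivity) (by positivity) ?_ ?_
  · intro r hr
    have h1 : ∀ θ : sphere (0:E) 1, f (r • (θ:E)) ≤ K * r := fun θ => by
      have := (le_abs_self _).trans (h.f_le (r • (θ:E)))
      rwa [norm_smul_sphere hr.1] at this
    have h2 := integral_mono (μ := ν.toSphere) (integrable_sphere_cont (by fun_prop)) (integrable_const _) h1
    rw [integral_const, smul_eq_mul] at h2
    exact h2.trans_eq (by ring)
  · intro R hR
    have hR0 := hR.1
    have hR1 : R ≤ 1 := hR.2.trans h.rho_le
    have e1 : R ^ (γs/2) * R ≤ 1 := mul_le_one₀ (rpow_le_one hR0.le hR1 (by positivity)) hR0.le hR1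
    have h1 := h.growth1 (ε := R ^ (γs/2)) hR (rpow_pos_of_pos hR0 _) e1
    rw [h.growth2eq hR0 hd, Measure.addHaar_real_closedBall ν 0 hR0.le] at h1
    have e2 : (R ^ (γs/2) * R) ^ γs / R ^ (γs/2) ≤ R ^ (γs/2) := by
      rw [div_le_iff₀ (rpow_pos_of_pos hR0 _), ← rpow_add hR0, ← rpow_add_one hR0.ne', ← rpow_mul hR0.le]
      apply rpow_le_rpow_of_exponent_ge hR0 hR1
      nlinarith
    have e3 : R ^ Module.finrank ℝ E = R ^ (k+1) := by congr 1; omega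
    rw [e3] at h1
    have e4 : R ^ (γs/2) / 2 + M * (R ^ (γs/2) * R) ^ γs / R ^ (γs/2) ≤ (1/2 + M) * R ^ (γs/2) := by
      rw [mul_div_assoc]
      have := mul_le_mul_of_nonneg_left e2 hM
      linarith
    have e5 := mul_le_mul_of_nonneg_left e4 (mul_nonneg (pow_nonneg hR0.le (k+1)) hω0)
    have e6 := h1.trans e5
    have e7 : R ^ (k+1) * ω * ((1/2 + M) * R ^ (γs/2)) = ω * (1/2 + M) * (R ^ (k+1) * R ^ (γs/2)) := by ring
    rw [e7] at e6
    linarith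

theorem Core.growth [Nontrivial E] (h : Core ν f D g K ρ M γs C1) (hd : 2 ≤ Module.finrank ℝ E) :
    ∃ ρ' α : ℝ, 0 < ρ' ∧ ρ' ≤ ρ ∧ 0 < α ∧ ∀ x ∈ closedBall (0:E) ρ', f x ≤ ‖x‖ ^ (1 + α) := by
  obtain ⟨C', α, hC', hα, hU⟩ := h.growth3 hd
  set k := Module.finrank ℝ E - 1 with hk
  have hk1 : Module.finrank ℝ E = k + 1 := by omega
  have hρ := h.rho_pos
  set ω : ℝ := ν.real (ball (0:E) 1) with hω
  have hω0 : 0 < ω := by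
    rw [hω, measureReal_def]
    exact ENNReal.toReal_pos (measure_ball_pos ν 0 one_pos).ne' measure_ball_lt_top.ne
  set L : ℝ := K + 1 with hL
  have hL0 : 0 < L := by positivity
  set C3 : ℝ := C' * 2 ^ (k+2) * 2 ^ α * 2 * (2 * L) ^ (k+1) / ω with hC3
  have hC30 : 0 ≤ C3 := by positivity
  have ht : Filter.Tendsto (fun r : ℝ => C3 * r ^ (α/2)) (nhds 0) (nhds (C3 * 0 ^ (α/2))) :=
    ((continuousAt_id.rpow_const (Or.inr (by positivity))).const_mul C3 : _)
  rw [zero_rpow (by positivity), mul_zero] at ht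
  obtain ⟨η, hη, hη2⟩ := Metric.eventually_nhds_iff.1 (ht.eventually (gt_mem_nhds one_pos))
  refine ⟨min (ρ/2) (η/2), α/2/(k+2), by positivity, (min_le_left _ _).trans (by linarith), by positivity, ?_⟩
  intro x hx
  rw [mem_closedBall_zero_iff] at hx
  have hxρ := hx.trans (min_le_left _ _)
  have hxη := hx.trans (min_le_right _ _)
  rcases le_or_gt (f x) 0 with hm | hm
  · exact hm.trans (rpow_nonneg (norm_nonneg _) _)
  set m := f x with hmdef
  set r := ‖x‖ with hr
  have hmr : m ≤ K * r := (le_abs_self _).trans (h.f_le x)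
  have hr0 : 0 < r := by
    rcases (norm_nonneg x).eq_or_lt with h0 | h0
    · rw [hr, ← h0] at hmr; simp at hmr; linarith
    · exact h0
  set s := m / (2 * L) with hs
  have hs0 : 0 < s := by positivity
  have hsr : s ≤ r := by
    rw [hs, div_le_iff₀ (by positivity)]
    have : (K:ℝ) * r ≤ r * (2 * L) := by rw [hL]; nlinarith [K.2]
    linarith
  have hsub : closedBall x s ⊆ closedBall (0:E) (2*r) := by
    apply closedBall_subset_closedBall'
    rw [dist_zero_right]; linarith
  have hsub2 : closedBall (0:E) (2*r) ⊆ closedBall (0:E) ρ := closedBall_subset_closedBall (by linarith)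
  have hfm := h.lip.continuous.measurable
  have hfb : ∀ y ∈ closedBall (0:E) (2*r), |f y| ≤ K * (2 * r) := fun y hy => by
    rw [mem_closedBall_zero_iff] at hy
    exact (h.f_le y).trans (by gcongr)
  have hint : IntegrableOn f (closedBall (0:E) (2*r)) ν := bdd_integrableOn hfm hfb
  have low : m / 2 * (s ^ (k+1) * ω) ≤ ∫ y in closedBall (0:E) (2*r), f y ∂ν := by
    have h1 : ∫ y in closedBall x s, m / 2 ∂ν ≤ ∫ y in closedBall x s, f y ∂ν := by
      refine setIntegral_mono_on (integrableOn_const (isCompact_closedBall x s).measure_lt_top.ne) 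
        (hint.mono_set hsub) measurableSet_closedBall fun y hy => ?_
      have h2 := h.lip.dist_le_mul x y
      rw [mem_closedBall, dist_comm] at hy
      have h3 : (K:ℝ) * dist x y ≤ m / 2 := by
        calc (K:ℝ) * dist x y ≤ L * s := mul_le_mul (by rw [hL]; linarith) hy dist_nonneg hL0.le
          _ = m / 2 := by rw [hs]; field_simp
      have h4 := (le_abs_self _).trans (h2.trans h3)
      linarith
    rw [setIntegral_const, Measure.addHaar_real_closedBall ν x hs0.le, hk1, smul_eq_mul, mul_comm] at h1
    refine h1.trans (setIntegral_mono_set hint ?_ (Filter.Eventually.of_forall hsub))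
    filter_upwards [ae_restrict_mem measurableSet_closedBall] with y hy
    exact h.nn y (hsub2 hy)
  have up : ∫ y in closedBall (0:E) (2*r), f y ∂ν ≤ (2*r)^(k+2) * (2*r)^α * C' := by
    rw [polar_integral ν (by positivity) hfm hfb, ← hk]
    have hc := continuous_sphere_integral (ν := ν) h.lip.continuous
    have h1 : (∫ t in (0:ℝ)..(2*r), t ^ k * ∫ θ : sphere (0:E) 1, f (t • (θ:E)) ∂ν.toSphere) ≤ 
        ∫ t in (0:ℝ)..(2*r), (2*r)^k * (C' * ((2*r) * (2*r)^α)) := by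
      refine intervalIntegral.integral_mono_on (by positivity) ((by fun_prop : Continuous _).intervalIntegrable _ _) 
        (by simp) fun t ht => ?_
      have h2 := hU t ⟨ht.1, ht.2.trans (by linarith)⟩
      have h3 : C' * (t * t ^ α) ≤ C' * ((2*r) * (2*r)^α) := by
        have a1 := ht.1
        have a2 := ht.2
        gcongr
      calc _ ≤ t ^ k * (C' * ((2*r) * (2*r)^α)) := mul_le_mul_of_nonneg_left (h2.trans h3) (pow_nonneg ht.1 k)
        _ ≤ _ := mul_le_mul_of_nonneg_right (pow_le_pow_left₀ ht.1 ht.2 k) (by positivity)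
    refine h1.trans_eq ?_
    rw [intervalIntegral.integral_const, smul_eq_mul]
    ring
  have h5 : m ^ (k+2) ≤ r^(k+2) * (C3 * r ^ α) := by
    have h6 := low.trans up
    rw [hs, div_pow, mul_rpow (by norm_num) hr0.le, mul_pow 2 r] at h6
    have e : r^(k+2) * (C3 * r ^ α) = (2 ^ (k + 2) * r ^ (k + 2) * (2 ^ α * r ^ α) * C') * (2 * (2 * L) ^ (k+1) / ω) := by
      rw [hC3]; ring
    rw [e, ← div_le_iff₀ (by positivity)]
    refine le_trans (le_of_eq ?_) h6
    field_simp
    ring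
  have h6 : C3 * r ^ α ≤ r ^ (α/2) := by
    have h7 : C3 * r ^ (α/2) < 1 := hη2 (by rw [dist_zero_right, norm_eq_abs, abs_of_pos hr0]; linarith)
    have e : r ^ α = r ^ (α/2) * r ^ (α/2) := by rw [← rpow_add hr0]; congr 1; ring
    rw [e, ← mul_assoc]
    have := rpow_nonneg hr0.le (α/2)
    nlinarith
  have h7 : m ^ (k+2) ≤ (r ^ (1 + α/2/(k+2))) ^ (k+2) := by
    refine h5.trans ((mul_le_mul_of_nonneg_left h6 (by positivity)).trans_eq ?_)
    rw [← rpow_natCast, ← rpow_natCast, ← rpow_mul hr0.le, ← rpow_add hr0]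
    congr 1
    push_cast
    field_simp
  exact le_of_pow_le_pow_left₀ (by omega) (rpow_nonneg hr0.le _) h7
end Core2


theorem rpow_sub_rpow_le' {w a b κ c : ℝ} (hw : 0 < w) (hw1 : w ≤ 1) (hκ : 0 < κ) (hab : a ≤ b) (hca : c ≤ a) :
    |w ^ a - w ^ b| ≤ (b - a) * (w ^ (c - κ) / κ) := by
  have h1 : w ^ b = w ^ a * w ^ (b - a) := by rw [← rpow_add hw]; congr 1; ring
  have h2 : w ^ (b-a) ≤ 1 := rpow_le_one hw.le hw1 (by linarith)
  have h3 : 1 - w ^ (b - a) ≤ (b - a) * (- log w) := by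
    rw [rpow_def_of_pos hw]
    have := add_one_le_exp (log w * (b - a))
    linarith
  have h4 : - log w ≤ w ^ (-κ) / κ := by
    have := log_le_rpow_div (x := w⁻¹) (by positivity) hκ
    rwa [log_inv, inv_rpow hw.le, ← rpow_neg hw.le] at this
  have h5 : w ^ a ≤ w ^ c := rpow_le_rpow_of_exponent_ge hw hw1 hca
  have h6 : 0 ≤ w ^ a := rpow_nonneg hw.le _
  have h7 : w ^ (c - κ) = w ^ c * w ^ (-κ) := by rw [← rpow_add hw]; congr 1
  have h8 : 0 ≤ w ^ (-κ) / κ := by positivity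
  have h9 : 0 ≤ w ^ c := rpow_nonneg hw.le _
  rw [abs_of_nonneg (by rw [h1]; nlinarith), h1, h7]
  calc w ^ a - w ^ a * w ^ (b - a) = w ^ a * (1 - w ^ (b - a)) := by ring
    _ ≤ w ^ a * ((b - a) * (w ^ (-κ) / κ)) := by
        refine mul_le_mul_of_nonneg_left (h3.trans ?_) h6
        exact mul_le_mul_of_nonneg_left h4 (by linarith)
    _ ≤ w ^ c * ((b - a) * (w ^ (-κ) / κ)) := mul_le_mul_of_nonneg_right h5 (mul_nonneg (by linarith) h8)
    _ = _ := by ring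

theorem rpow_sub_rpow_le {w a b κ c : ℝ} (hw : 0 < w) (hw1 : w ≤ 1) (hκ : 0 < κ) (hca : c ≤ a) (hcb : c ≤ b) :
    |w ^ a - w ^ b| ≤ |a - b| * (w ^ (c - κ) / κ) := by
  rcases le_total a b with h | h
  · rw [abs_sub_comm a b, abs_of_nonneg (by linarith : 0 ≤ b - a)]
    exact rpow_sub_rpow_le' hw hw1 hκ h hca
  · rw [abs_sub_comm, abs_of_nonneg (by linarith : 0 ≤ a - b)]
    exact rpow_sub_rpow_le' hw hw1 hκ h hcb

section Core3
variable {E : Type*} [NormedAddCommGroup E] [InnerProductSpace ℝ E] [FiniteDimensional ℝ E]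
  [CompleteSpace E] [MeasurableSpace E] [BorelSpace E]
variable {ν : Measure E} [ν.IsAddHaarMeasure] {f D g : E → ℝ} {K : NNReal} {ρ M γs C1 : ℝ}

theorem Core.g0_pos (h : Core ν f D g K ρ M γs C1) : 0 < g 0 :=
  h.gs_pos.trans_le (h.g_ge 0 (by simpa using h.rho_pos.le))
theorem Core.g0_le (h : Core ν f D g K ρ M γs C1) : g 0 ≤ 1 :=
  (h.g_le 0 (by simpa using h.rho_pos.le))

theorem Core.pot_err (h : Core ν f D g K ρ M γs C1) {α : ℝ} (hα : 0 < α) :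
    ∃ C q ρ1 : ℝ, 0 ≤ C ∧ 0 < ρ1 ∧ 2 * g 0 / (2 - g 0) < q ∧ ∀ r ∈ Ioc 0 ρ1, r ≤ ρ → ∀ x ∈ closedBall (0:E) r,
      ∀ w, 0 ≤ w → w ≤ r ^ (1 + α) → |D x * w ^ g x - D 0 * w ^ g 0| ≤ C * r ^ q := by
  have hg0 := h.g0_pos
  have hg1 := h.g0_le
  have hM : 0 ≤ M := (h.D_nn 0).trans (h.D_le 0)
  set κ : ℝ := α * g 0 / (4 * (1 + α)) with hκdef
  have hκ : 0 < κ := by positivity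
  have hκ2 : κ * (1 + α) = α * g 0 / 4 := by rw [hκdef]; field_simp
  have hκ3 : 2 * κ ≤ g 0 := by nlinarith
  refine ⟨|C1| * (1 + M / κ), 1 + (1 + α) * (g 0 - 2 * κ), κ / (|C1| + 1), by positivity, by positivity, ?_, ?_⟩
  · rw [div_lt_iff₀ (by linarith)]
    have e : 1 + (1 + α) * (g 0 - 2 * κ) = 1 + g 0 + α * g 0 - 2 * (κ * (1 + α)) := by ring
    rw [e, hκ2]
    have : 0 < α * g 0 := by positivity
    nlinarith
  · intro r hr hrρ x hx w hw0 hw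
    have hxρ : x ∈ closedBall (0:E) ρ := closedBall_subset_closedBall hrρ hx
    have hr1 : r ≤ 1 := hrρ.trans h.rho_le
    have hr0 := hr.1
    have hRHS : 0 ≤ |C1| * (1 + M / κ) * r ^ (1 + (1 + α) * (g 0 - 2 * κ)) := by positivity
    have hgx := h.gs_pos.trans_le (h.g_ge x hxρ)
    rcases hw0.eq_or_lt with h0 | h0
    · rw [← h0, zero_rpow hgx.ne', zero_rpow hg0.ne']
      simpa using hRHS
    rw [mem_closedBall_zero_iff] at hx
    have hw1 : w ≤ 1 := hw.trans (rpow_le_one hr0.le hr1 (by positivity))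
    have hC1x : C1 * ‖x‖ ≤ |C1| * r := mul_le_mul (le_abs_self _) hx (norm_nonneg _) (abs_nonneg _)
    have hDx := (h.D_lip x hxρ).trans hC1x
    have hgx2 := (h.g_lip x hxρ).trans hC1x
    have hsm : |C1| * r ≤ κ := by
      have := hr.2
      rw [le_div_iff₀ (by positivity)] at this
      nlinarith
    have hlow : g 0 - κ ≤ g x := by
      have := (abs_le.1 (hgx2.trans hsm)).1
      linarith
    have b1 := rpow_sub_rpow_le h0 hw1 hκ hlow (by linarith : g 0 - κ ≤ g 0)
    have e1 : g 0 - κ - κ = g 0 - 2 * κ := by ring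
    rw [e1] at b1
    have b2 : w ^ g x ≤ w ^ (g 0 - 2 * κ) := rpow_le_rpow_of_exponent_ge h0 hw1 (by linarith)
    have b3 : w ^ (g 0 - 2 * κ) ≤ r ^ ((1 + α) * (g 0 - 2 * κ)) := by
      rw [rpow_mul hr0.le]
      exact rpow_le_rpow hw0 hw (by linarith)
    have b4 : 0 ≤ w ^ (g 0 - 2 * κ) := rpow_nonneg hw0 _
    calc |D x * w ^ g x - D 0 * w ^ g 0| = |(D x - D 0) * w ^ g x + D 0 * (w ^ g x - w ^ g 0)| := by congr 1; ring
      _ ≤ |(D x - D 0) * w ^ g x| + |D 0 * (w ^ g x - w ^ g 0)| := abs_add_le _ _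
      _ = |D x - D 0| * w ^ g x + D 0 * |w ^ g x - w ^ g 0| := by
          rw [abs_mul, abs_mul, abs_of_nonneg (rpow_nonneg hw0 _), abs_of_nonneg (h.D_nn 0)]
      _ ≤ (|C1| * r) * w ^ (g 0 - 2 * κ) + M * ((|C1| * r) * (w ^ (g 0 - 2 * κ) / κ)) := by
          refine add_le_add (mul_le_mul hDx b2 (rpow_nonneg hw0 _) (by positivity)) ?_
          refine mul_le_mul (h.D_le 0) (b1.trans ?_) (abs_nonneg _) hM
          exact mul_le_mul_of_nonneg_right hgx2 (by positivity)
      _ = |C1| * (1 + M / κ) * (r * w ^ (g 0 - 2 * κ)) := by ring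
      _ ≤ |C1| * (1 + M / κ) * (r * r ^ ((1 + α) * (g 0 - 2 * κ))) := by gcongr
      _ = _ := by rw [rpow_add hr0, rpow_one]
end Core3


theorem rpow_sub_le_mul {s t β : ℝ} (hs : 0 ≤ s) (hst : s ≤ t) (ht : t ≤ 1) (hβ : 1 ≤ β) :
    t ^ β - s ^ β ≤ β * (t - s) := by
  rcases (hs.trans hst).eq_or_lt with h | h
  · have : s = 0 := le_antisymm (by linarith) hs
    rw [← h, this]; simp
  · have h1 := one_add_mul_self_le_rpow_one_add (s := s / t - 1) (by have : 0 ≤ s / t := by positivity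
                                                                     linarith) hβ
    have h2 : 1 + (s / t - 1) = s / t := by ring
    rw [h2, div_rpow hs h.le, le_div_iff₀ (rpow_pos_of_pos h _)] at h1
    have h3 : t ^ β = t ^ (β - 1) * t := by rw [← rpow_add_one h.ne']; congr 1; ring
    have h4 : t ^ (β - 1) ≤ 1 := rpow_le_one h.le ht (by linarith)
    have h5 : (1 + β * (s / t - 1)) * t ^ β = t ^ β - t ^ (β - 1) * (β * (t - s)) := by
      rw [h3]; field_simp; ring
    have h6 : t ^ (β - 1) * (β * (t - s)) ≤ 1 * (β * (t - s)) :=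
      mul_le_mul_of_nonneg_right h4 (mul_nonneg (by linarith) (by linarith))
    linarith

section Hom
variable {E : Type*} [NormedAddCommGroup E] [InnerProductSpace ℝ E] [FiniteDimensional ℝ E]
  [CompleteSpace E] [MeasurableSpace E] [BorelSpace E]

/-- homogeneous replacement of `f` in the ball of radius `r` -/
def homRep (f : E → ℝ) (β r : ℝ) (x : E) : ℝ :=
  (min (‖x‖ / r) 1) ^ β * f ((min (‖x‖ / r) 1)⁻¹ • x)

theorem homRep_outside {f : E → ℝ} {β r : ℝ} (hr : 0 < r) {x : E} (hx : r ≤ ‖x‖) : homRep f β r x = f x := by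
  have : min (‖x‖ / r) 1 = 1 := min_eq_right (by rwa [le_div_iff₀ hr, one_mul])
  simp [homRep, this]

theorem homRep_inside {f : E → ℝ} {β r : ℝ} (hr : 0 < r) {x : E} (hx : ‖x‖ ≤ r) :
    homRep f β r x = (‖x‖ / r) ^ β * f ((r * ‖x‖⁻¹) • x) := by
  have : min (‖x‖ / r) 1 = ‖x‖ / r := min_eq_left (by rwa [div_le_iff₀ hr, one_mul])
  simp only [homRep, this]
  rw [inv_div, div_eq_mul_inv r]

theorem homRep_lip {f : E → ℝ} {β r : ℝ} {K : NNReal} (hf : LipschitzWith K f) (hf0 : f 0 = 0) (hr : 0 < r) (hβ : 1 ≤ β) :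
    LipschitzWith (K * (2 + Real.toNNReal β)) (homRep f β r) := by
  have key : ∀ x y : E, ‖y‖ ≤ ‖x‖ → |homRep f β r x - homRep f β r y| ≤ K * (2 + β) * ‖x - y‖ := by
    intro x y hyx
    have hfx : ∀ z, |f z| ≤ K * ‖z‖ := fun z => by
      have := hf.dist_le_mul z 0
      simpa [hf0, dist_eq_norm] using this
    set t := min (‖x‖ / r) 1 with ht
    set s := min (‖y‖ / r) 1 with hs
    have hs0 : 0 ≤ s := le_min (by positivity) zero_le_one
    have hst : s ≤ t := min_le_min_right _ (by gcongr)
    have ht1 : t ≤ 1 := min_le_right _ _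
    have hK : (0:ℝ) ≤ K := K.2
    have htx : t * r ≤ ‖x‖ := by
      have := min_le_left (‖x‖ / r) 1
      rwa [← ht, le_div_iff₀ hr] at this
    have htb : t ^ β ≤ t := by
      have := rpow_le_rpow_of_exponent_ge_of_imp (hs0.trans hst) ht1 hβ (by intro _ h; linarith)
      simpa using this
    rcases hs0.eq_or_lt with h0 | h0
    · have hy0 : y = 0 := by
        by_contra hne
        have : 0 < ‖y‖ / r := by positivity
        have : 0 < s := lt_min this one_pos
        linarith
      have hvy : homRep f β r y = 0 := by
        subst hy0; simp [homRep, hf0]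
      rw [hvy, sub_zero, hy0, sub_zero]
      rcases (hs0.trans hst).eq_or_lt with h1 | h1
      · have : homRep f β r x = 0 := by
          simp only [homRep, ← ht, ← h1]
          rw [zero_rpow (by linarith), zero_mul]
        rw [this, abs_zero]
        positivity
      · simp only [homRep, ← ht]
        rw [abs_mul, abs_of_nonneg (rpow_nonneg h1.le _)]
        have h2 := hfx (t⁻¹ • x)
        rw [norm_smul, norm_inv, norm_eq_abs, abs_of_pos h1] at h2
        calc _ ≤ t * (K * (t⁻¹ * ‖x‖)) := mul_le_mul htb h2 (abs_nonneg _) h1.le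
          _ = K * 1 * ‖x‖ := by field_simp
          _ ≤ _ := by gcongr; linarith
    · have ht0 := h0.trans_le hst
      have hmax : (t - s) * ‖s⁻¹ • y‖ ≤ ‖x - y‖ := by
        rw [norm_smul, norm_inv, norm_eq_abs, abs_of_pos h0]
        have h3 := norm_sub_norm_le x y
        rcases le_total (‖y‖ / r) 1 with h2 | h2
        · have e : s = ‖y‖ / r := min_eq_left h2
          have hy0 : 0 < ‖y‖ := by
            rw [e] at h0
            by_contra hne
            have : ‖y‖ = 0 := le_antisymm (not_lt.1 hne) (norm_nonneg _)
            rw [this] at h0; simp at h0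
          have e2 : s⁻¹ * ‖y‖ = r := by rw [e]; field_simp
          have e3 : s * r = ‖y‖ := by rw [e]; field_simp
          rw [e2]
          linarith
        · have e : s = 1 := min_eq_right h2
          have e' : t = 1 := le_antisymm ht1 (e ▸ hst)
          rw [e, e']; simp
      have h1 : |f (t⁻¹ • x) - f (s⁻¹ • y)| ≤ K * ‖t⁻¹ • x - s⁻¹ • y‖ := by
        have := hf.dist_le_mul (t⁻¹ • x) (s⁻¹ • y)
        rwa [Real.dist_eq, dist_eq_norm] at this
      have h2 : t * ‖t⁻¹ • x - s⁻¹ • y‖ ≤ 2 * ‖x - y‖ := by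
        calc t * ‖t⁻¹ • x - s⁻¹ • y‖ = ‖t • (t⁻¹ • x - s⁻¹ • y)‖ := by rw [norm_smul, norm_eq_abs, abs_of_pos ht0]
          _ = ‖(x - y) - (t - s) • (s⁻¹ • y)‖ := by
              congr 1
              rw [smul_sub, smul_smul, mul_inv_cancel₀ ht0.ne', one_smul, sub_smul, smul_smul s, mul_inv_cancel₀ h0.ne', one_smul]
              abel
          _ ≤ ‖x - y‖ + ‖(t - s) • (s⁻¹ • y)‖ := norm_sub_le _ _
          _ ≤ ‖x - y‖ + ‖x - y‖ := by
              rw [norm_smul, norm_eq_abs, abs_of_nonneg (by linarith)]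
              linarith
          _ = _ := by ring
      have h3 := rpow_sub_le_mul hs0 hst ht1 hβ
      have h4 : 0 ≤ t ^ β - s ^ β := by
        have := rpow_le_rpow hs0 hst (by linarith : 0 ≤ β)
        linarith
      have h5 := hfx (s⁻¹ • y)
      simp only [homRep, ← ht, ← hs]
      calc |t ^ β * f (t⁻¹ • x) - s ^ β * f (s⁻¹ • y)| 
          = |t ^ β * (f (t⁻¹ • x) - f (s⁻¹ • y)) + (t ^ β - s ^ β) * f (s⁻¹ • y)| := by congr 1; ring
        _ ≤ |t ^ β * (f (t⁻¹ • x) - f (s⁻¹ • y))| + |(t ^ β - s ^ β) * f (s⁻¹ • y)| := abs_add_le _ _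
        _ = t ^ β * |f (t⁻¹ • x) - f (s⁻¹ • y)| + (t ^ β - s ^ β) * |f (s⁻¹ • y)| := by
            rw [abs_mul, abs_mul, abs_of_nonneg h4, abs_of_nonneg (rpow_nonneg ht0.le _)]
        _ ≤ t * (K * ‖t⁻¹ • x - s⁻¹ • y‖) + (β * (t - s)) * (K * ‖s⁻¹ • y‖) := by
            refine add_le_add (mul_le_mul htb h1 (abs_nonneg _) ht0.le) (mul_le_mul h3 h5 (abs_nonneg _) ?_)
            exact mul_nonneg (by linarith) (by linarith)
        _ = K * (t * ‖t⁻¹ • x - s⁻¹ • y‖) + K * β * ((t - s) * ‖s⁻¹ • y‖) := by ring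
        _ ≤ K * (2 * ‖x - y‖) + K * β * ‖x - y‖ := by gcongr
        _ = _ := by ring
  refine LipschitzWith.of_dist_le_mul fun x y => ?_
  rw [Real.dist_eq, dist_eq_norm]
  push_cast
  rw [Real.coe_toNNReal _ (by linarith)]
  rcases le_total ‖y‖ ‖x‖ with h | h
  · exact key x y h
  · rw [abs_sub_comm, norm_sub_rev]; exact key y x h

theorem homRep_ray {f : E → ℝ} {β r ϱ : ℝ} (hϱ : 0 < ϱ) (hϱr : ϱ ≤ r) {θ : E} (hθ : ‖θ‖ = 1) :
    homRep f β r (ϱ • θ) = (ϱ / r) ^ β * f (r • θ) := by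
  have h1 : ‖ϱ • θ‖ = ϱ := by rw [norm_smul, hθ, mul_one, norm_eq_abs, abs_of_pos hϱ]
  rw [homRep_inside (hϱ.trans_le hϱr) (by rw [h1]; exact hϱr), h1, smul_smul]
  congr 3
  field_simp

theorem homRep_gradient {f : E → ℝ} {β r ϱ : ℝ} (hϱ : 0 < ϱ) (hϱr : ϱ < r) {θ : E} (hθ : ‖θ‖ = 1)
    (hd : DifferentiableAt ℝ f (r • θ)) :
    ‖gradient (homRep f β r) (ϱ • θ)‖ ^ 2 = (ϱ / r) ^ (2 * β - 2) * (β ^ 2 * f (r • θ) ^ 2 / r ^ 2 + 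
      ‖gradient f (r • θ)‖ ^ 2 - inner ℝ (gradient f (r • θ)) θ ^ 2) := by
  have hr := hϱ.trans hϱr
  have h1 : ‖ϱ • θ‖ = ϱ := by rw [norm_smul, hθ, mul_one, norm_eq_abs, abs_of_pos hϱ]
  have hne : ϱ • θ ≠ 0 := by intro h; rw [h, norm_zero] at h1; exact hϱ.ne h1
  set G := gradient f (r • θ) with hG
  set V : E := (ϱ / r) ^ (β - 1) • ((β * f (r • θ) / r) • θ + G - (inner ℝ G θ) • θ) with hV
  have hgr : HasGradientAt (homRep f β r) V (ϱ • θ) := by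
    have hn : HasFDerivAt (fun y : E => ‖y‖) (InnerProductSpace.toDual ℝ E θ) (ϱ • θ) := by
      have := (hasFDerivAt_norm' hne).hasFDerivAt
      rwa [h1, smul_smul, inv_mul_cancel₀ hϱ.ne', one_smul] at this
    have a1 : HasFDerivAt (fun y : E => (‖y‖ / r) ^ β) ((β * (ϱ / r) ^ (β - 1)) • (r⁻¹ • InnerProductSpace.toDual ℝ E θ)) (ϱ • θ) := by
      have b1 : HasFDerivAt (fun y : E => ‖y‖ / r) (r⁻¹ • InnerProductSpace.toDual ℝ E θ) (ϱ • θ) := by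
        have := hn.mul_const (r⁻¹)
        simpa only [div_eq_mul_inv] using this
      have b2 := b1.rpow_const (p := β) (Or.inl (by rw [h1]; positivity))
      rwa [h1] at b2
    have a2 : HasFDerivAt (fun y : E => r * ‖y‖⁻¹) ((-(r / ϱ ^ 2)) • InnerProductSpace.toDual ℝ E θ) (ϱ • θ) := by
      have b1 : HasDerivAt (fun t : ℝ => r * t⁻¹) (-(r / ϱ ^ 2)) ‖ϱ • θ‖ := by
        rw [h1]
        have := (hasDerivAt_inv hϱ.ne').const_mul r
        have e : -(r / ϱ ^ 2) = r * -(ϱ ^ 2)⁻¹ := by rw [div_eq_mul_inv]; ring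
        rw [e]; exact this
      exact b1.comp_hasFDerivAt _ hn
    have a3 : HasFDerivAt (fun y : E => (r * ‖y‖⁻¹) • y) _ (ϱ • θ) := a2.smul (hasFDerivAt_id _)
    have e3 : (r * ‖ϱ • θ‖⁻¹) • (ϱ • θ) = r • θ := by
      rw [h1, smul_smul]; congr 1; field_simp
    have a4 : HasFDerivAt f (InnerProductSpace.toDual ℝ E G) ((r * ‖ϱ • θ‖⁻¹) • (ϱ • θ)) := by
      rw [e3]; exact hd.hasGradientAt.hasFDerivAt
    have a5 := a1.mul (HasFDerivAt.comp (f := fun y : E => (r * ‖y‖⁻¹) • y) (ϱ • θ) a4 a3)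
    simp only [Function.comp_apply] at a5
    rw [e3, h1] at a5
    have a6 : HasFDerivAt (fun y : E => (‖y‖ / r) ^ β * f ((r * ‖y‖⁻¹) • y)) (InnerProductSpace.toDual ℝ E V) (ϱ • θ) := by
      have e : InnerProductSpace.toDual ℝ E V = (ϱ / r) ^ β • ((InnerProductSpace.toDual ℝ E G : E →L[ℝ] ℝ).comp ((r * ϱ⁻¹) • ContinuousLinearMap.id ℝ E +
            ContinuousLinearMap.smulRight ((-(r / ϱ ^ 2)) • InnerProductSpace.toDual ℝ E θ : E →L[ℝ] ℝ) (ϱ • θ))) +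
            f (r • θ) • ((β * (ϱ / r) ^ (β - 1)) • (r⁻¹ • InnerProductSpace.toDual ℝ E θ)) := by
          ext y
          have e5 : (ϱ / r) ^ β = (ϱ / r) ^ (β - 1) * (ϱ / r) := by
            rw [← rpow_add_one (by positivity)]; congr 1; ring
          simp only [hV, InnerProductSpace.toDual_apply_apply, ContinuousLinearMap.add_apply, ContinuousLinearMap.smul_apply,
            ContinuousLinearMap.comp_apply, ContinuousLinearMap.smulRight_apply, ContinuousLinearMap.id_apply, id,
            inner_add_left, inner_sub_left, inner_add_right, real_inner_smul_left, real_inner_smul_right, smul_eq_mul, e5]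
          field_simp
          ring
      rw [e]
      exact a5
    refine HasGradientAt.congr_of_eventuallyEq (hasGradientAt_iff_hasFDerivAt.2 a6) ?_
    have : ∀ᶠ y in nhds (ϱ • θ), ‖y‖ < r := (continuous_norm.tendsto _).eventually (gt_mem_nhds (by rw [h1]; exact hϱr))
    filter_upwards [this] with y hy
    exact homRep_inside hr hy.le
  rw [hgr.gradient, hV, norm_smul, mul_pow, norm_eq_abs, sq_abs]
  have e6 : ((ϱ / r) ^ (β - 1)) ^ 2 = (ϱ / r) ^ (2 * β - 2) := by
    rw [← rpow_natCast, ← rpow_mul (by positivity)]; congr 1; push_cast; ring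
  rw [e6]
  congr 1
  rw [← real_inner_self_eq_norm_sq, ← real_inner_self_eq_norm_sq]
  have h7 : inner ℝ θ θ = (1:ℝ) := by rw [real_inner_self_eq_norm_sq, hθ]; norm_num
  simp only [inner_add_left, inner_sub_left, inner_add_right, inner_sub_right, real_inner_smul_left, real_inner_smul_right, h7,
    real_inner_comm G θ]
  field_simp
  ring
end Hom


section Cmp
variable {E : Type*} [NormedAddCommGroup E] [InnerProductSpace ℝ E] [FiniteDimensional ℝ E]
  [CompleteSpace E] [MeasurableSpace E] [BorelSpace E]
variable {ν : Measure E} [ν.IsAddHaarMeasure] {f D g : E → ℝ} {K : NNReal} {ρ M γs C1 : ℝ}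

theorem energy0_meas {v : E → ℝ} (hv : Continuous v) (D0 g0 : ℝ) :
    Measurable (fun x => (1:ℝ)/2 * ‖gradient v x‖ ^ 2 + D0 * v x ^ g0) := by
  have h1 := measurable_gradient' v
  have h2 := hv.measurable
  fun_prop

theorem energy0_bdd {v : E → ℝ} {K' : NNReal} (hv : LipschitzWith K' v) {D0 g0 B : ℝ} (hD0 : 0 ≤ D0) (hg0 : 0 ≤ g0) (hg1 : g0 ≤ 1)
    {x : E} (hx : 0 ≤ v x) (hxB : v x ≤ B) :
    |(1:ℝ)/2 * ‖gradient v x‖ ^ 2 + D0 * v x ^ g0| ≤ 1 / 2 * (K':ℝ) ^ 2 + D0 * (1 + B) := by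
  have h1 := norm_gradient_le_lip hv x
  have h2 := rpow_bdd hx hxB hg0 hg1
  have h3 := rpow_nonneg hx g0
  rw [abs_of_nonneg (by positivity)]
  gcongr

theorem Core.compare [Nontrivial E] (h : Core ν f D g K ρ M γs C1) (hd : 2 ≤ Module.finrank ℝ E) {β N : ℝ}
    (hβ : β = 2 / (2 - g 0)) (hN : N = Module.finrank ℝ E + 2 * β - 2) :
    ∃ ρ2 C q : ℝ, 0 < ρ2 ∧ ρ2 ≤ ρ ∧ 0 ≤ C ∧ 2 * β - 2 < q ∧ ∀ᵐ r ∂(volume : Measure ℝ), r ∈ Ioc 0 ρ2 →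
      ∫ x in closedBall (0:E) r, ((1:ℝ)/2 * ‖gradient f x‖ ^ 2 + D 0 * f x ^ g 0) ∂ν ≤
      r ^ (Module.finrank ℝ E) / N * (∫ θ : sphere (0:E) 1, ((1:ℝ)/2 * (β ^ 2 * f (r • (θ:E)) ^ 2 / r ^ 2 +
        ‖gradient f (r • (θ:E))‖ ^ 2 - inner ℝ (gradient f (r • (θ:E))) (θ:E) ^ 2) + D 0 * f (r • (θ:E)) ^ g 0) ∂ν.toSphere)
      + C * (r ^ (Module.finrank ℝ E) * r ^ q) := by
  obtain ⟨ρ', α, hρ'0, hρ'ρ, hα, hgrow⟩ := h.growth hd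
  obtain ⟨C, q, ρ1, hC, hρ1, hq, herr⟩ := h.pot_err hα
  have hg0 := h.g0_pos
  have hg1 := h.g0_le
  have hβg : 2 * g 0 / (2 - g 0) = 2 * β - 2 := by
    have : 2 - g 0 ≠ 0 := by linarith
    rw [hβ]; field_simp; ring
  have hβg' : β * g 0 = 2 * β - 2 := by rw [← hβg, hβ]; ring
  have hβ1 : 1 ≤ β := by
    rw [hβ, le_div_iff₀ (by linarith)]; linarith
  rw [hβg] at hq
  set ω : ℝ := ν.real (ball (0:E) 1) with hω
  have hω0 : 0 ≤ ω := measureReal_nonneg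
  set d := Module.finrank ℝ E with hdd
  have hN0 : 0 < N := by
    have : (2:ℝ) ≤ d := by exact_mod_cast hd
    rw [hN]; linarith
  refine ⟨min ρ' ρ1, 2 * C * ω, q, lt_min hρ'0 hρ1, (min_le_left _ _).trans hρ'ρ, by positivity, hq, ?_⟩
  filter_upwards [polar_ae_right ν (h.lip.ae_differentiableAt (μ := ν))] with r hrd hr
  have hr0 := hr.1
  replace hrd := hrd hr0
  have hr1 : r ≤ ρ' := hr.2.trans (min_le_left _ _)
  have hr2 : r ≤ ρ1 := hr.2.trans (min_le_right _ _)
  have hrρ : r ≤ ρ := hr1.trans hρ'ρ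
  have hrone : r ≤ 1 := hrρ.trans h.rho_le
  set v := homRep f β r with hv
  have hvlip := homRep_lip (r := r) (β := β) h.lip h.f0 hr0 hβ1
  have hfnn : ∀ x ∈ closedBall (0:E) r, 0 ≤ f x := fun x hx => h.nn x (closedBall_subset_closedBall hrρ hx)
  have hfB : ∀ x ∈ closedBall (0:E) r, f x ≤ r ^ (1 + α) := fun x hx => by
    have hx' := mem_closedBall_zero_iff.1 hx
    exact (hgrow x (closedBall_subset_closedBall hr1 hx)).trans (rpow_le_rpow (norm_nonneg _) hx' (by linarith))
  have hvin : ∀ x ∈ closedBall (0:E) r, 0 ≤ v x ∧ v x ≤ r ^ (1 + α) := by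
    intro x hx
    have hx' := mem_closedBall_zero_iff.1 hx
    rw [hv, homRep_inside hr0 hx']
    have hmem : (r * ‖x‖⁻¹) • x ∈ closedBall (0:E) r := by
      rw [mem_closedBall_zero_iff, norm_smul, norm_mul, norm_inv, norm_norm, norm_eq_abs, abs_of_pos hr0, mul_assoc]
      exact mul_le_of_le_one_right hr0.le inv_mul_le_one
    have h1 : 0 ≤ (‖x‖ / r) ^ β := by positivity
    have h2 : (‖x‖ / r) ^ β ≤ 1 := rpow_le_one (by positivity) (by rwa [div_le_one hr0]) (by linarith)
    refine ⟨mul_nonneg h1 (hfnn _ hmem), ?_⟩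
    calc _ ≤ 1 * r ^ (1 + α) := mul_le_mul h2 (hfB _ hmem) (hfnn _ hmem) zero_le_one
      _ = _ := one_mul _
  have hvnn := fun x hx => (hvin x hx).1
  have hvB := fun x hx => (hvin x hx).2
  have hmin := h.isMin r ⟨hr0, hrρ⟩ v ⟨_, hvlip⟩ (fun x hx => homRep_outside hr0 (by
    rw [mem_closedBall_zero_iff, not_le] at hx; exact hx.le)) hvnn
  have hIf := h.energy_int (ν := ν) h.lip hrρ hfnn hfB
  have hIv := h.energy_int (ν := ν) hvlip hrρ hvnn hvB
  have hIf0 : IntegrableOn (fun x => (1:ℝ)/2 * ‖gradient f x‖ ^ 2 + D 0 * f x ^ g 0) (closedBall (0:E) r) ν :=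
    bdd_integrableOn (energy0_meas h.lip.continuous _ _) fun x hx => energy0_bdd h.lip (h.D_nn 0) hg0.le hg1 (hfnn x hx) (hfB x hx)
  have hv0b : ∀ x ∈ closedBall (0:E) r, |(1:ℝ)/2 * ‖gradient v x‖ ^ 2 + D 0 * v x ^ g 0| ≤ _ :=
    fun x hx => energy0_bdd hvlip (h.D_nn 0) hg0.le hg1 (hvnn x hx) (hvB x hx)
  have hv0m := energy0_meas hvlip.continuous (D 0) (g 0)
  have hIv0 : IntegrableOn (fun x => (1:ℝ)/2 * ‖gradient v x‖ ^ 2 + D 0 * v x ^ g 0) (closedBall (0:E) r) ν :=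
    bdd_integrableOn hv0m hv0b
  have hc : IntegrableOn (fun _ : E => C * r ^ q) (closedBall (0:E) r) ν :=
    integrableOn_const (isCompact_closedBall (0:E) r).measure_lt_top.ne
  have hvol : ν.real (closedBall (0:E) r) = r ^ d * ω := Measure.addHaar_real_closedBall ν 0 hr0.le
  have i1 : ∫ x in closedBall (0:E) r, ((1:ℝ)/2 * ‖gradient f x‖ ^ 2 + D 0 * f x ^ g 0) ∂ν ≤
      (∫ x in closedBall (0:E) r, ((1:ℝ)/2 * ‖gradient f x‖ ^ 2 + D x * f x ^ g x) ∂ν) + r ^ d * ω * (C * r ^ q) := by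
    have := setIntegral_mono_on hIf0 (hIf.add hc) measurableSet_closedBall (fun x hx => by
      have := (abs_le.1 (herr r ⟨hr0, hr2⟩ hrρ x hx (f x) (hfnn x hx) (hfB x hx))).1
      simp only [Pi.add_apply]
      linarith)
    simp only [Pi.add_apply] at this
    rwa [integral_add hIf hc, setIntegral_const, smul_eq_mul, hvol] at this
  have i2 : ∫ x in closedBall (0:E) r, ((1:ℝ)/2 * ‖gradient v x‖ ^ 2 + D x * v x ^ g x) ∂ν ≤
      (∫ x in closedBall (0:E) r, ((1:ℝ)/2 * ‖gradient v x‖ ^ 2 + D 0 * v x ^ g 0) ∂ν) + r ^ d * ω * (C * r ^ q) := by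
    have := setIntegral_mono_on hIv (hIv0.add hc) measurableSet_closedBall (fun x hx => by
      have := (abs_le.1 (herr r ⟨hr0, hr2⟩ hrρ x hx (v x) (hvnn x hx) (hvB x hx))).2
      simp only [Pi.add_apply]
      linarith)
    simp only [Pi.add_apply] at this
    rwa [integral_add hIv0 hc, setIntegral_const, smul_eq_mul, hvol] at this
  set I : ℝ := ∫ θ : sphere (0:E) 1, ((1:ℝ)/2 * (β ^ 2 * f (r • (θ:E)) ^ 2 / r ^ 2 +
        ‖gradient f (r • (θ:E))‖ ^ 2 - inner ℝ (gradient f (r • (θ:E))) (θ:E) ^ 2) + D 0 * f (r • (θ:E)) ^ g 0) ∂ν.toSphere with hI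
  have i3 : ∫ x in closedBall (0:E) r, ((1:ℝ)/2 * ‖gradient v x‖ ^ 2 + D 0 * v x ^ g 0) ∂ν = r ^ d / N * I := by
    rw [polar_integral ν hr0.le hv0m hv0b]
    have e1 : (∫ ϱ in (0:ℝ)..r, ϱ ^ (Module.finrank ℝ E - 1) * ∫ θ : sphere (0:E) 1, 
        ((1:ℝ)/2 * ‖gradient v (ϱ • (θ:E))‖ ^ 2 + D 0 * v (ϱ • (θ:E)) ^ g 0) ∂ν.toSphere) = 
        ∫ ϱ in (0:ℝ)..r, ϱ ^ (N - 1) * (r ^ (-(2 * β - 2)) * I) := by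
      refine intervalIntegral.integral_congr_ae ?_
      have hne : ∀ᵐ ϱ ∂(volume : Measure ℝ), ϱ ≠ r := by simp [ae_iff]
      filter_upwards [hne] with ϱ hϱne hϱ
      rw [uIoc_of_le hr0.le] at hϱ
      have hϱr : ϱ < r := lt_of_le_of_ne hϱ.2 hϱne
      have hϱ0 := hϱ.1
      have e2 : ∫ θ : sphere (0:E) 1, 
        ((1:ℝ)/2 * ‖gradient v (ϱ • (θ:E))‖ ^ 2 + D 0 * v (ϱ • (θ:E)) ^ g 0) ∂ν.toSphere = (ϱ / r) ^ (2 * β - 2) * I := by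
        rw [hI, ← integral_const_mul]
        refine integral_congr_ae ?_
        filter_upwards [hrd] with θ hθ
        have hθ1 : ‖(θ:E)‖ = 1 := by simp
        have hfr : 0 ≤ f (r • (θ:E)) := hfnn _ (by rw [mem_closedBall_zero_iff, norm_smul_sphere hr0.le])
        rw [hv, homRep_gradient hϱ0 hϱr hθ1 hθ, homRep_ray hϱ0 hϱr.le hθ1, mul_rpow (by positivity) hfr, 
          ← rpow_mul (by positivity), hβg']
        ring
      rw [e2, div_rpow hϱ0.le hr0.le, rpow_neg hr0.le]
      have e3 : ϱ ^ (N - 1) = ϱ ^ (Module.finrank ℝ E - 1) * ϱ ^ (2 * β - 2) := by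
        rw [← rpow_natCast, ← rpow_add hϱ0, hN]
        congr 1
        rw [Nat.cast_sub (by omega)]; push_cast; ring
      rw [e3]; ring
    rw [e1, intervalIntegral.integral_mul_const, integral_rpow (Or.inl (by linarith)), sub_add_cancel, zero_rpow hN0.ne', sub_zero]
    have e4 : r ^ N = r ^ d * r ^ (2 * β - 2) := by
      rw [← rpow_natCast, ← rpow_add hr0, hN]
      congr 1; ring
    rw [e4, rpow_neg hr0.le]
    have : 0 < r ^ (2 * β - 2) := rpow_pos_of_pos hr0 _
    field_simp
  rw [i3] at i2
  calc _ ≤ _ := i1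
    _ ≤ _ := add_le_add_left (hmin.trans i2) _
    _ = _ := by ring
end Cmp


theorem sq_integral_le {φ : ℝ → ℝ} {a b : ℝ} (hab : a < b) (h1 : IntervalIntegrable φ volume a b)
    (h2 : IntervalIntegrable (fun r => φ r ^ 2) volume a b) :
    (∫ r in a..b, φ r) ^ 2 ≤ (b - a) * ∫ r in a..b, φ r ^ 2 := by
  set A := ∫ r in a..b, φ r with hA
  set m := A / (b - a) with hm
  have hba : 0 < b - a := by linarith
  have h3 : 0 ≤ ∫ r in a..b, (φ r ^ 2 - 2 * m * φ r + m ^ 2) := by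
    refine intervalIntegral.integral_nonneg hab.le fun r _ => ?_
    nlinarith [sq_nonneg (φ r - m)]
  rw [intervalIntegral.integral_add (h2.sub (h1.const_mul _)) (by simp), intervalIntegral.integral_sub h2 (h1.const_mul _),
    intervalIntegral.integral_const_mul, intervalIntegral.integral_const, smul_eq_mul, ← hA] at h3
  have h4 : m * (b - a) = A := by rw [hm]; field_simp
  have h5 : 0 ≤ (b - a) * ((∫ r in a..b, φ r ^ 2) - 2 * m * A + (b - a) * m ^ 2) := mul_nonneg hba.le h3
  have h6 : (b - a) * ((∫ r in a..b, φ r ^ 2) - 2 * m * A + (b - a) * m ^ 2) = 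
    (b - a) * (∫ r in a..b, φ r ^ 2) - 2 * (m * (b - a)) * A + (m * (b - a)) ^ 2 := by ring
  rw [h6, h4] at h5
  nlinarith

section Weiss
variable {E : Type*} [NormedAddCommGroup E] [InnerProductSpace ℝ E] [FiniteDimensional ℝ E]
  [CompleteSpace E] [MeasurableSpace E] [BorelSpace E]

/-- radial derivative of the rescaled function -/
def omg (f : E → ℝ) (β : ℝ) (θ : sphere (0:E) 1) (r : ℝ) : ℝ :=
  (-β * r ^ (-β - 1)) * f (r • (θ:E)) + r ^ (-β) * inner ℝ (gradient f (r • (θ:E))) (θ:E)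

variable {f : E → ℝ} {K : NNReal} {β : ℝ}

theorem omg_meas (hf : Continuous f) : Measurable (fun q : sphere (0:E) 1 × ℝ => omg f β q.1 q.2) := by
  have := measurable_gradient' f
  unfold omg
  fun_prop

theorem w_bdd (hf : LipschitzWith K f) (hf0 : f 0 = 0) (hβ : 0 ≤ β) {a b : ℝ} (ha : 0 < a) (θ : sphere (0:E) 1) {r : ℝ} (hr : r ∈ Icc a b) :
    |r ^ (-β) * f (r • (θ:E))| ≤ a ^ (-β) * (K * b) := by
  have hr0 := ha.trans_le hr.1
  have h1 : r ^ (-β) ≤ a ^ (-β) := rpow_le_rpow_of_nonpos ha hr.1 (by linarith)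
  have h2 : |f (r • (θ:E))| ≤ K * r := by
    have := hf.dist_le_mul (r • (θ:E)) 0
    rwa [hf0, dist_zero_right, dist_zero_right, norm_smul_sphere hr0.le] at this
  rw [abs_mul, abs_of_pos (rpow_pos_of_pos hr0 _)]
  have h3 : (K:ℝ) * r ≤ K * b := by have := hr.2; gcongr
  exact mul_le_mul h1 (h2.trans h3) (abs_nonneg _) (by positivity)

theorem omg_bdd (hf : LipschitzWith K f) (hf0 : f 0 = 0) (hβ : 0 ≤ β) {a b : ℝ} (ha : 0 < a) (θ : sphere (0:E) 1) {r : ℝ} (hr : r ∈ Icc a b) :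
    |omg f β θ r| ≤ a ^ (-β) * (β * K + K) := by
  have hr0 := ha.trans_le hr.1
  have h1 : r ^ (-β) ≤ a ^ (-β) := rpow_le_rpow_of_nonpos ha hr.1 (by linarith)
  have h2 : |f (r • (θ:E))| ≤ K * r := by
    have := hf.dist_le_mul (r • (θ:E)) 0
    rwa [hf0, dist_zero_right, dist_zero_right, norm_smul_sphere hr0.le] at this
  have h4 := abs_real_inner_le_norm (gradient f (r • (θ:E))) (θ:E)
  rw [norm_eq_of_mem_sphere, mul_one] at h4
  have h5 := h4.trans (norm_gradient_le_lip hf _)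
  have e : omg f β θ r = r ^ (-β) * (-(β * (f (r • (θ:E)) / r)) + inner ℝ (gradient f (r • (θ:E))) (θ:E)) := by
    rw [omg, rpow_sub_one hr0.ne']; ring
  rw [e, abs_mul, abs_of_pos (rpow_pos_of_pos hr0 _)]
  have h6 : |f (r • (θ:E)) / r| ≤ K := by rw [abs_div, abs_of_pos hr0, div_le_iff₀ hr0]; exact h2
  refine mul_le_mul h1 ((abs_add_le _ _).trans (add_le_add ?_ h5)) (abs_nonneg _) (by positivity)
  rw [abs_neg, abs_mul, abs_of_nonneg hβ]
  gcongr

variable (ν : Measure E) [ν.IsAddHaarMeasure]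

theorem w_ac [Nontrivial E] (hf : LipschitzWith K f) {a b : ℝ} (ha : 0 < a) (hab : a ≤ b) :
    ∀ᵐ θ : sphere (0:E) 1 ∂ν.toSphere, AbsolutelyContinuousOnInterval (fun r => r ^ (-β) * f (r • (θ:E))) a b ∧
      ∀ᵐ r ∂(volume : Measure ℝ), r ∈ Ioc a b → HasDerivAt (fun r => r ^ (-β) * f (r • (θ:E))) (omg f β θ r) r := by
  refine ray_ac ν hf (c := fun r => r ^ (-β)) (c' := fun r => -β * r ^ (-β - 1)) ha.le hab ?_ ?_
  · refine contDiffOn_id.rpow_const_of_ne fun x hx => ?_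
    rw [uIcc_of_le hab] at hx
    exact (ha.trans_le hx.1).ne'
  · intro r hr
    exact hasDerivAt_rpow_const (Or.inl (ha.trans hr.1).ne')

theorem h_diff [Nontrivial E] (hf : LipschitzWith K f) (hf0 : f 0 = 0) (hβ : 0 ≤ β) {a b : ℝ} (ha : 0 < a) (hab : a ≤ b) :
    (∫ θ : sphere (0:E) 1, (b ^ (-β) * f (b • (θ:E))) ^ 2 ∂ν.toSphere) - (∫ θ : sphere (0:E) 1, (a ^ (-β) * f (a • (θ:E))) ^ 2 ∂ν.toSphere) =
    ∫ r in a..b, ∫ θ : sphere (0:E) 1, 2 * (r ^ (-β) * f (r • (θ:E))) * omg f β θ r ∂ν.toSphere := by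
  have hfc := hf.continuous
  have hm : Measurable (fun q : sphere (0:E) 1 × ℝ => 2 * (q.2 ^ (-β) * f (q.2 • (q.1:E))) * omg f β q.1 q.2) := by
    have := omg_meas (β := β) hfc
    fun_prop
  have hb : ∀ θ : sphere (0:E) 1, ∀ r ∈ Ioc a b, |2 * (r ^ (-β) * f (r • (θ:E))) * omg f β θ r| ≤ 
      2 * (a ^ (-β) * (K * b)) * (a ^ (-β) * (β * K + K)) := by
    intro θ r hr
    have hr' : r ∈ Icc a b := Ioc_subset_Icc_self hr
    have h1 := w_bdd hf hf0 hβ ha θ hr'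
    have h2 := omg_bdd hf hf0 hβ ha θ hr'
    have hb0 : 0 ≤ b := ha.le.trans hab
    rw [abs_mul, abs_mul, abs_two]
    gcongr
  rw [← aux_swap ν (k := fun q => 2 * (q.2 ^ (-β) * f (q.2 • (q.1:E))) * omg f β q.1 q.2) hab hm hb, ← integral_sub]
  · refine integral_congr_ae ?_
    filter_upwards [w_ac (β := β) ν hf ha hab] with θ hθ
    have := ftc_ac (φ' := fun r => 2 * (r ^ (-β) * f (r • (θ:E))) * omg f β θ r) hab (hθ.1.fun_mul hθ.1) (by
      filter_upwards [hθ.2] with r hr hr2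
      have := (hr hr2).mul (hr hr2)
      have e : 2 * (r ^ (-β) * f (r • (θ:E))) * omg f β θ r = omg f β θ r * (r ^ (-β) * f (r • (θ:E))) + 
        (r ^ (-β) * f (r • (θ:E))) * omg f β θ r := by ring
      rw [e]; exact this)
    rw [this]; ring
  · exact integrable_sphere_cont (by fun_prop)
  · exact integrable_sphere_cont (by fun_prop)

/-- Cauchy-Schwarz along rays -/
theorem w_diff_sq [Nontrivial E] (hf : LipschitzWith K f) (hf0 : f 0 = 0) (hβ : 0 ≤ β) {a b : ℝ} (ha : 0 < a) (hab : a < b) :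
    (∫ θ : sphere (0:E) 1, (b ^ (-β) * f (b • (θ:E)) - a ^ (-β) * f (a • (θ:E))) ^ 2 ∂ν.toSphere) ≤
    ((b - a) / a) * ∫ r in a..b, r * ∫ θ : sphere (0:E) 1, omg f β θ r ^ 2 ∂ν.toSphere := by
  have hfc := hf.continuous
  have hom := omg_meas (β := β) hfc
  have hb0 : 0 < b := ha.trans hab
  set B := a ^ (-β) * (β * K + K) with hB
  have hob : ∀ θ : sphere (0:E) 1, ∀ r ∈ Ioc a b, |omg f β θ r| ≤ B := fun θ r hr => 
    omg_bdd hf hf0 hβ ha θ (Ioc_subset_Icc_self hr)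
  have hB0 : 0 ≤ B := by positivity
  have hm : Measurable (fun q : sphere (0:E) 1 × ℝ => q.2 * omg f β q.1 q.2 ^ 2) := by fun_prop
  have hb : ∀ θ : sphere (0:E) 1, ∀ r ∈ Ioc a b, |r * omg f β θ r ^ 2| ≤ b * B ^ 2 := by
    intro θ r hr
    have h1 := hob θ r hr
    rw [abs_mul, abs_of_pos (ha.trans hr.1), abs_pow]
    have := hr.2
    gcongr
  have hsw := aux_swap ν (k := fun q => q.2 * omg f β q.1 q.2 ^ 2) hab.le hm hb
  simp only [integral_const_mul] at hsw
  rw [← hsw, ← integral_const_mul]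
  refine integral_mono_ae (integrable_sphere_cont (by fun_prop)) 
    ((aux_integrable_left ν (k := fun q => q.2 * omg f β q.1 q.2 ^ 2) hab.le hm hb).const_mul _) ?_
  filter_upwards [w_ac (β := β) ν hf ha hab.le] with θ hθ
  have h1 := ftc_ac hab.le hθ.1 hθ.2
  have homθ : Measurable (fun r => omg f β θ r) := hom.comp (measurable_const.prodMk measurable_id)
  have ii : ∀ {φ : ℝ → ℝ} {C : ℝ}, Measurable φ → (∀ r ∈ Ioc a b, |φ r| ≤ C) → IntervalIntegrable φ volume a b := by
    intro φ C hφ hC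
    refine (intervalIntegrable_const (c := C)).mono_fun' hφ.aestronglyMeasurable ?_
    filter_upwards [ae_restrict_mem measurableSet_uIoc] with r hr
    rw [uIoc_of_le hab.le] at hr
    exact hC r hr
  have i1 := ii homθ (hob θ)
  have i2 : IntervalIntegrable (fun r => omg f β θ r ^ 2) volume a b := ii (C := B ^ 2) (homθ.pow_const 2) (fun r hr => by
    rw [abs_pow]; exact pow_le_pow_left₀ (abs_nonneg _) (hob θ r hr) 2)
  have i3 : IntervalIntegrable (fun r => r * omg f β θ r ^ 2) volume a b := ii (measurable_id.mul (homθ.pow_const 2)) (hb θ)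
  have h2 := sq_integral_le hab i1 i2
  rw [h1] at h2
  refine h2.trans ?_
  have h3 : a * (∫ r in a..b, omg f β θ r ^ 2) ≤ ∫ r in a..b, r * omg f β θ r ^ 2 := by
    rw [← intervalIntegral.integral_const_mul]
    refine intervalIntegral.integral_mono_on hab.le (i2.const_mul _) i3 fun r hr => ?_
    exact mul_le_mul_of_nonneg_right hr.1 (sq_nonneg _)
  calc (b - a) * (∫ r in a..b, omg f β θ r ^ 2) = (b - a) / a * (a * (∫ r in a..b, omg f β θ r ^ 2)) := by field_simp
    _ ≤ _ := mul_le_mul_of_nonneg_left h3 (div_nonneg (by linarith) ha.le)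
end Weiss


section Weiss2
variable {E : Type*} [NormedAddCommGroup E] [InnerProductSpace ℝ E] [FiniteDimensional ℝ E]
  [CompleteSpace E] [MeasurableSpace E] [BorelSpace E]

/-- Weiss energy -/
def weissW (ν : Measure E) (f : E → ℝ) (D0 g0 β N r : ℝ) : ℝ :=
  r ^ (-N) * (∫ x in closedBall (0:E) r, ((1:ℝ)/2 * ‖gradient f x‖ ^ 2 + D0 * f x ^ g0) ∂ν) -
    β / 2 * ∫ θ : sphere (0:E) 1, (r ^ (-β) * f (r • (θ:E))) ^ 2 ∂ν.toSphere

variable {ν : Measure E} [ν.IsAddHaarMeasure] {f D g : E → ℝ} {K : NNReal} {ρ M γs C1 : ℝ}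

theorem Core.weiss [Nontrivial E] (h : Core ν f D g K ρ M γs C1) (hd : 2 ≤ Module.finrank ℝ E) {β N : ℝ}
    (hβ : β = 2 / (2 - g 0)) (hN : N = Module.finrank ℝ E + 2 * β - 2) :
    ∃ ρ2 C s : ℝ, 0 < ρ2 ∧ ρ2 ≤ ρ ∧ 0 ≤ C ∧ 0 < s ∧ ∀ a b, 0 < a → a ≤ b → b ≤ ρ2 →
      1 / 2 * (∫ r in a..b, r * ∫ θ : sphere (0:E) 1, omg f β θ r ^ 2 ∂ν.toSphere) ≤
      (weissW ν f (D 0) (g 0) β N b + C * b ^ s) - (weissW ν f (D 0) (g 0) β N a + C * a ^ s) := by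
  obtain ⟨ρ2, C, q, hρ2, hρ2ρ, hC, hq, hcmp⟩ := h.compare hd hβ hN
  have hg0 := h.g0_pos
  have hg1 := h.g0_le
  have hβ1 : 1 ≤ β := by
    rw [hβ, le_div_iff₀ (by linarith)]; linarith
  have hN0 : 0 < N := by
    have : (2:ℝ) ≤ Module.finrank ℝ E := by exact_mod_cast hd
    rw [hN]; linarith
  set d := Module.finrank ℝ E with hdd
  have hs : 0 < q - (2 * β - 2) := by linarith
  set s := q - (2 * β - 2) with hsdef
  refine ⟨ρ2, N * C / s, s, hρ2, hρ2ρ, by positivity, hs, ?_⟩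
  intro a b ha hab hb
  have hb0 : 0 < b := ha.trans_le hab
  have hfc := h.lip.continuous
  set p : E → ℝ := fun x => (1:ℝ)/2 * ‖gradient f x‖ ^ 2 + D 0 * f x ^ g 0 with hp
  set P : ℝ := 1 / 2 * (K:ℝ) ^ 2 + D 0 * (1 + K * ρ2) with hP
  have hpm : Measurable p := energy0_meas hfc _ _
  have hpb : ∀ x ∈ closedBall (0:E) ρ2, |p x| ≤ P := fun x hx => by
    have hx' := mem_closedBall_zero_iff.1 hx
    refine energy0_bdd h.lip (h.D_nn 0) hg0.le hg1 (h.nn x (closedBall_subset_closedBall hρ2ρ hx)) ?_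
    refine ((le_abs_self _).trans (h.f_le x)).trans ?_
    gcongr
  have hP0 : 0 ≤ P := by have := h.D_nn 0; positivity
  have hpray : ∀ θ : sphere (0:E) 1, ∀ r ∈ Ioc 0 ρ2, |p (r • (θ:E))| ≤ P := fun θ r hr =>
    hpb _ (by rw [mem_closedBall_zero_iff, norm_smul_sphere hr.1.le]; exact hr.2)
  set e0 : ℝ → ℝ := fun r => ∫ θ : sphere (0:E) 1, p (r • (θ:E)) ∂ν.toSphere with he0
  set G : ℝ → ℝ := fun r => ∫ t in (0:ℝ)..r, t ^ (d - 1) * e0 t with hG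
  have hGp : ∀ r ∈ Icc 0 ρ2, ∫ x in closedBall (0:E) r, p x ∂ν = G r := fun r hr => by
    rw [polar_integral ν hr.1 hpm (fun x hx => hpb x (closedBall_subset_closedBall hr.2 hx))]
  -- absolute continuity of G
  have hpolm : Measurable (fun q : sphere (0:E) 1 × ℝ => p (q.2 • (q.1:E))) := hpm.comp measurable_polar
  have hint0 : IntervalIntegrable (fun t => t ^ (d - 1) * e0 t) volume 0 ρ2 := by
    have := aux_intervalIntegrable ν (k := fun q => q.2 ^ (d-1) * p (q.2 • (q.1:E))) (C := ρ2 ^ (d-1) * P) hρ2.le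
      ((measurable_snd.pow_const _).mul hpolm) (fun θ r hr => by
        rw [abs_mul, abs_of_nonneg (pow_nonneg hr.1.le _)]
        exact mul_le_mul (pow_le_pow_left₀ hr.1.le hr.2 _) (hpray θ r hr) (abs_nonneg _) (by positivity))
    simpa only [integral_const_mul] using this
  have hsubI : Icc a b ⊆ Icc 0 ρ2 := Icc_subset_Icc ha.le hb
  have hint1 : IntervalIntegrable (fun t => t ^ (d - 1) * e0 t) volume 0 b :=
    hint0.mono_set (by rw [uIcc_of_le hb0.le, uIcc_of_le hρ2.le]; exact Icc_subset_Icc le_rfl hb)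
  have hint2 : IntervalIntegrable (fun t => t ^ (d - 1) * e0 t) volume a b :=
    hint0.mono_set (by rw [uIcc_of_le hab, uIcc_of_le hρ2.le]; exact hsubI)
  have hGac : AbsolutelyContinuousOnInterval G a b := by
    have e1 : AbsolutelyContinuousOnInterval G 0 ρ2 :=
      hint0.absolutelyContinuousOnInterval_intervalIntegral (by simp)
    exact e1.mono (by rw [uIcc_of_le hab, uIcc_of_le hρ2.le]; exact hsubI)
  have hGd : ∀ᵐ r ∂(volume : Measure ℝ), r ∈ Ioc a b → HasDerivAt G (r ^ (d - 1) * e0 r) r := by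
    filter_upwards [hint0.ae_hasDerivAt_integral] with r hr hr2
    refine hr ?_ 0 (by simp)
    rw [uIcc_of_le hρ2.le]
    exact hsubI (Ioc_subset_Icc_self hr2)
  have hne : ∀ r ∈ uIcc a b, r ≠ 0 := fun r hr => by
    rw [uIcc_of_le hab] at hr
    exact (ha.trans_le hr.1).ne'
  have hrp : ∀ p : ℝ, ContDiffOn ℝ 1 (fun r : ℝ => r ^ p) (uIcc a b) := fun p =>
    contDiffOn_id.rpow_const_of_ne hne
  have hrpc : ∀ p : ℝ, ContinuousOn (fun r : ℝ => r ^ p) (uIcc a b) := fun p => (hrp p).continuousOn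
  set J' : ℝ → ℝ := fun r => (-N * r ^ (-N - 1)) * G r + r ^ (-N) * (r ^ (d-1) * e0 r) with hJ'
  have hJ : ∫ r in a..b, J' r = b ^ (-N) * G b - a ^ (-N) * G a := by
    refine ftc_ac (φ := fun r => r ^ (-N) * G r) hab ((hrp (-N)).absolutelyContinuousOnInterval.fun_mul hGac) ?_
    filter_upwards [hGd] with r hr hr2
    exact (hasDerivAt_rpow_const (Or.inl (ha.trans hr2.1).ne')).mul (hr hr2)
  have hJi : IntervalIntegrable J' volume a b := by
    refine IntervalIntegrable.add ?_ (hint2.continuousOn_mul (hrpc (-N)))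
    exact (((hrpc (-N-1)).const_mul (-N)).mul hGac.continuousOn).intervalIntegrable
  have hβ0 : 0 ≤ β := by linarith
  have hh := h_diff ν h.lip h.f0 hβ0 ha hab
  have hom := omg_meas (β := β) hfc
  set B := a ^ (-β) * (β * K + K) with hB
  have hB0 : 0 ≤ B := by positivity
  have hob : ∀ θ : sphere (0:E) 1, ∀ r ∈ Ioc a b, |omg f β θ r| ≤ B := fun θ r hr => 
    omg_bdd h.lip h.f0 hβ0 ha θ (Ioc_subset_Icc_self hr)
  set B2 := a ^ (-β) * (K * b) with hB2
  have hB20 : 0 ≤ B2 := by positivity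
  have hwb : ∀ θ : sphere (0:E) 1, ∀ r ∈ Ioc a b, |r ^ (-β) * f (r • (θ:E))| ≤ B2 := fun θ r hr => 
    w_bdd h.lip h.f0 hβ0 ha θ (Ioc_subset_Icc_self hr)
  have hi1 : IntervalIntegrable (fun r => ∫ θ : sphere (0:E) 1, 2 * (r ^ (-β) * f (r • (θ:E))) * omg f β θ r ∂ν.toSphere) volume a b := by
    refine aux_intervalIntegrable ν (k := fun q => 2 * (q.2 ^ (-β) * f (q.2 • (q.1:E))) * omg f β q.1 q.2) (C := 2 * B2 * B) hab
      (by fun_prop) ?_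
    intro θ r hr
    have h1 := hob θ r hr
    have h2 := hwb θ r hr
    rw [abs_mul, abs_mul, abs_two]
    gcongr
  have hi2 : IntervalIntegrable (fun r => r * ∫ θ : sphere (0:E) 1, omg f β θ r ^ 2 ∂ν.toSphere) volume a b := by
    have := aux_intervalIntegrable ν (k := fun q => omg f β q.1 q.2 ^ 2) (C := B ^ 2) hab (by fun_prop) (fun θ r hr => by
      rw [abs_pow]; exact pow_le_pow_left₀ (abs_nonneg _) (hob θ r hr) 2)
    exact this.continuousOn_mul continuousOn_id
  have hi3 : IntervalIntegrable (fun r : ℝ => r ^ (s - 1)) volume a b := (hrpc (s-1)).intervalIntegrable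
  -- the main differential inequality
  have main : ∀ᵐ r ∂(volume : Measure ℝ), r ∈ Ioc a b →
      1 / 2 * (r * ∫ θ : sphere (0:E) 1, omg f β θ r ^ 2 ∂ν.toSphere) ≤
      J' r - β / 2 * (∫ θ : sphere (0:E) 1, 2 * (r ^ (-β) * f (r • (θ:E))) * omg f β θ r ∂ν.toSphere) + N * C * r ^ (s - 1) := by
    filter_upwards [hcmp] with r hr hrab
    have hr0 : 0 < r := ha.trans hrab.1
    have hr2 : r ∈ Ioc 0 ρ2 := ⟨hr0, hrab.2.trans hb⟩
    replace hr := hr hr2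
    rw [hGp r (Ioc_subset_Icc_self hr2)] at hr
    have mθ : Measurable (fun θ : sphere (0:E) 1 => omg f β θ r) := hom.comp (measurable_id.prodMk measurable_const)
    have hgm := measurable_gradient' f
    have bint : ∀ {φ : sphere (0:E) 1 → ℝ} {c : ℝ}, Measurable φ → (∀ θ, |φ θ| ≤ c) → Integrable φ ν.toSphere := by
      intro φ c hφ hc
      exact Integrable.mono' (integrable_const c) hφ.aestronglyMeasurable (Filter.Eventually.of_forall hc)
    have j1 : Integrable (fun θ : sphere (0:E) 1 => p (r • (θ:E))) ν.toSphere := 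
      bint (hpm.comp (by fun_prop)) (fun θ => hpray θ r hr2)
    have j2 : Integrable (fun θ : sphere (0:E) 1 => omg f β θ r ^ 2) ν.toSphere := 
      bint (c := B ^ 2) (mθ.pow_const 2) (fun θ => by rw [abs_pow]; exact pow_le_pow_left₀ (abs_nonneg _) (hob θ r hrab) 2)
    have j3 : Integrable (fun θ : sphere (0:E) 1 => 2 * (r ^ (-β) * f (r • (θ:E))) * omg f β θ r) ν.toSphere := 
      bint (c := 2 * B2 * B) (by fun_prop) (fun θ => by 
        have h1 := hob θ r hrab
        have h2 := hwb θ r hrab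
        rw [abs_mul, abs_mul, abs_two]
        gcongr)
    have hk1 : d = (d - 1) + 1 := by omega
    -- pointwise identity
    have hI : r ^ (1 - 2 * β) * (∫ θ : sphere (0:E) 1, ((1:ℝ)/2 * (β ^ 2 * f (r • (θ:E)) ^ 2 / r ^ 2 +
        ‖gradient f (r • (θ:E))‖ ^ 2 - inner ℝ (gradient f (r • (θ:E))) (θ:E) ^ 2) + D 0 * f (r • (θ:E)) ^ g 0) ∂ν.toSphere) =
        r ^ (1 - 2 * β) * e0 r - 1 / 2 * (r * ∫ θ : sphere (0:E) 1, omg f β θ r ^ 2 ∂ν.toSphere) - 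
          β / 2 * (∫ θ : sphere (0:E) 1, 2 * (r ^ (-β) * f (r • (θ:E))) * omg f β θ r ∂ν.toSphere) := by
      rw [he0]
      simp only []
      have j12 : Integrable (fun θ : sphere (0:E) 1 => r ^ (1-2*β) * p (r • (θ:E)) - 1/2 * r * omg f β θ r ^ 2) ν.toSphere :=
        (j1.const_mul _).sub (j2.const_mul _)
      rw [← integral_const_mul, ← integral_const_mul, ← mul_assoc, ← integral_const_mul, ← integral_const_mul,
        ← integral_sub (j1.const_mul _) (j2.const_mul _), ← integral_sub j12 (j3.const_mul _)]
      congr 1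
      ext θ
      have e1 : r ^ (1 - 2 * β) = r ^ (-β) * r ^ (-β) * r := by
        rw [← rpow_add hr0, ← rpow_add_one hr0.ne']; congr 1; ring
      have e2 : omg f β θ r = r ^ (-β) * (inner ℝ (gradient f (r • (θ:E))) (θ:E) - β * f (r • (θ:E)) / r) := by
        rw [omg, rpow_sub_one hr0.ne']; ring
      rw [e1, e2]
      simp only [hp]
      field_simp
      ring
    have e3 : r ^ (-N) * r ^ (d - 1) = r ^ (1 - 2 * β) := by
      rw [← rpow_natCast, ← rpow_add hr0, hN, Nat.cast_sub (by omega)]; congr 1; push_cast; ring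
    have e4 : N * r ^ (-N - 1) * (r ^ d / N) = r ^ (1 - 2 * β) := by
      rw [← e3, rpow_sub_one hr0.ne']
      nth_rewrite 1 [hk1]
      rw [pow_succ]
      field_simp
    have e5 : N * r ^ (-N - 1) * (C * (r ^ d * r ^ q)) = N * C * r ^ (s - 1) := by
      have : r ^ (-N - 1) * (r ^ d * r ^ q) = r ^ (s - 1) := by
        rw [← rpow_natCast, ← rpow_add hr0, ← rpow_add hr0]; congr 1; rw [hsdef, hN]; ring
      rw [← this]; ring
    have h5 := mul_le_mul_of_nonneg_left hr (by positivity : 0 ≤ N * r ^ (-N - 1))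
    rw [mul_add, e5, ← mul_assoc (N * r ^ (-N - 1)), e4, hI] at h5
    have e6 : J' r = - (N * r ^ (-N - 1) * G r) + r ^ (1 - 2 * β) * e0 r := by
      rw [hJ']; simp only []; rw [← e3]; ring
    rw [e6]
    linarith
  have h9 := intervalIntegral.integral_mono_ae_restrict (μ := volume) hab (hi2.const_mul (1/2))
    ((hJi.sub (hi1.const_mul (β/2))).add (hi3.const_mul (N * C))) (by
      have := (ae_restrict_iff' measurableSet_Ioc).2 main
      rw [Measure.restrict_congr_set Ioc_ae_eq_Icc] at this
      exact this)
  rw [intervalIntegral.integral_const_mul, intervalIntegral.integral_add (hJi.sub (hi1.const_mul _)) (hi3.const_mul _),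
    intervalIntegral.integral_sub hJi (hi1.const_mul _), intervalIntegral.integral_const_mul, intervalIntegral.integral_const_mul,
    hJ, ← hh, integral_rpow (Or.inl (by linarith)), sub_add_cancel] at h9
  refine h9.trans_eq ?_
  simp only [weissW]
  rw [hGp b ⟨hb0.le, hb⟩, hGp a ⟨ha.le, hab.trans hb⟩]
  ring
end Weiss2


section Concl
variable {E : Type*} [NormedAddCommGroup E] [InnerProductSpace ℝ E] [FiniteDimensional ℝ E]
  [CompleteSpace E] [MeasurableSpace E] [BorelSpace E]
variable {ν : Measure E} [ν.IsAddHaarMeasure] {f D g : E → ℝ} {K : NNReal} {ρ M γs C1 : ℝ}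

theorem sphere_lim {F : ℕ → E → ℝ} {u₀ : E → ℝ} (hFc : ∀ j, Continuous (F j)) (hu : Continuous u₀)
    (hconv : ∀ S : Set E, IsCompact S → TendstoUniformlyOn F u₀ Filter.atTop S) {a b : ℝ} (ha : 0 < a) (hb : 0 < b) (A B : ℝ) :
    Filter.Tendsto (fun j => ∫ θ : sphere (0:E) 1, (A * F j (a • (θ:E)) - B * F j (b • (θ:E))) ^ 2 ∂ν.toSphere) Filter.atTop
      (nhds (∫ θ : sphere (0:E) 1, (A * u₀ (a • (θ:E)) - B * u₀ (b • (θ:E))) ^ 2 ∂ν.toSphere)) := by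
  set S := closedBall (0:E) (max a b) with hS
  have hSc : IsCompact S := isCompact_closedBall _ _
  have hma : ∀ θ : sphere (0:E) 1, a • (θ:E) ∈ S := fun θ => by
    rw [hS, mem_closedBall_zero_iff, norm_smul_sphere ha.le]; exact le_max_left _ _
  have hmb : ∀ θ : sphere (0:E) 1, b • (θ:E) ∈ S := fun θ => by
    rw [hS, mem_closedBall_zero_iff, norm_smul_sphere hb.le]; exact le_max_right _ _
  have hc := hconv S hSc
  obtain ⟨U, hU⟩ := hSc.exists_bound_of_continuousOn hu.continuousOn
  refine tendsto_integral_filter_of_dominated_convergence (fun _ => (|A| * (U + 1) + |B| * (U + 1)) ^ 2) ?_ ?_ (integrable_const _) ?_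
  · refine Filter.Eventually.of_forall fun j => Continuous.aestronglyMeasurable ?_
    have := hFc j
    fun_prop
  · have := Metric.tendstoUniformlyOn_iff.1 hc 1 one_pos
    filter_upwards [this] with j hj
    refine Filter.Eventually.of_forall fun θ => ?_
    have key : ∀ x ∈ S, |F j x| ≤ U + 1 := fun x hx => by
      have h1 := hj x hx
      have h2 := hU x hx
      rw [dist_comm, Real.dist_eq] at h1
      rw [norm_eq_abs] at h2
      have := abs_sub_abs_le_abs_sub (F j x) (u₀ x)
      linarith
    rw [norm_eq_abs, abs_pow]
    refine pow_le_pow_left₀ (abs_nonneg _) ?_ 2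
    refine (abs_sub _ _).trans ?_
    rw [abs_mul, abs_mul]
    have h1 := key _ (hma θ)
    have h2 := key _ (hmb θ)
    gcongr
  · refine Filter.Eventually.of_forall fun θ => ?_
    exact (((hc.tendsto_at (hma θ)).const_mul A).sub ((hc.tendsto_at (hmb θ)).const_mul B)).pow 2

theorem Core.homog [Nontrivial E] (h : Core ν f D g K ρ M γs C1) (hd : 2 ≤ Module.finrank ℝ E) {β : ℝ}
    (hβ : β = 2 / (2 - g 0)) (r : ℕ → ℝ) (hrpos : ∀ j, 0 < r j)
    (hrlim : Filter.Tendsto r Filter.atTop (nhds 0)) (u₀ : E → ℝ) (hu : Continuous u₀)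
    (hconv : ∀ S : Set E, IsCompact S → TendstoUniformlyOn (fun j x => f (r j • x) / (r j) ^ β) u₀ Filter.atTop S) :
    ∀ lam : ℝ, 0 < lam → ∀ x : E, u₀ (lam • x) = lam ^ β * u₀ x := by
  obtain ⟨ρ2, C, s, hρ2, hρ2ρ, hC, hs, hW⟩ := h.weiss hd hβ (N := Module.finrank ℝ E + 2 * β - 2) rfl
  set N := (Module.finrank ℝ E : ℝ) + 2 * β - 2 with hN
  have hg0 := h.g0_pos
  have hg1 := h.g0_le
  have hfc := h.lip.continuous
  have hβ0 : 0 ≤ β := by rw [hβ]; exact div_nonneg (by norm_num) (by linarith)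
  set W : ℝ → ℝ := fun t => weissW ν f (D 0) (g 0) β N t + C * t ^ s with hWdef
  have homnn : ∀ a b, 0 < a → a ≤ b → 0 ≤ ∫ r in a..b, r * ∫ θ : sphere (0:E) 1, omg f β θ r ^ 2 ∂ν.toSphere := by
    intro a b ha hab
    refine intervalIntegral.integral_nonneg hab fun t ht => mul_nonneg (ha.le.trans ht.1) ?_
    exact integral_nonneg fun θ => sq_nonneg _
  have hmono : MonotoneOn W (Ioo 0 ρ2) := by
    intro a ha b hb hab
    have h1 := hW a b ha.1 hab hb.2.le
    have h2 := homnn a b ha.1 hab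
    simp only [hWdef]; linarith
  set F : ℕ → E → ℝ := fun j x => f (r j • x) / (r j) ^ β with hF
  have hFc : ∀ j, Continuous (F j) := fun j => by simp only [hF]; fun_prop
  have hw : ∀ j (l : ℝ) (θ : sphere (0:E) 1), 0 < l → (l * r j) ^ (-β) * f ((l * r j) • (θ:E)) = l ^ (-β) * F j (l • (θ:E)) := by
    intro j l θ hl
    have e : (l * r j) • (θ:E) = r j • l • (θ:E) := by rw [smul_smul, mul_comm]
    simp only [hF]
    rw [e, mul_rpow hl.le (hrpos j).le, rpow_neg (hrpos j).le]
    field_simp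
  have hscale : ∀ l, 0 < l → Filter.Tendsto (fun j => l * r j) Filter.atTop (nhdsWithin 0 (Ioi 0)) := by
    intro l hl
    refine tendsto_nhdsWithin_iff.2 ⟨?_, Filter.Eventually.of_forall fun j => mul_pos hl (hrpos j)⟩
    simpa using hrlim.const_mul l
  -- lower bound
  have hWlow : ∀ t ∈ Ioo 0 ρ2, -(β / 2 * ∫ θ : sphere (0:E) 1, (t ^ (-β) * f (t • (θ:E))) ^ 2 ∂ν.toSphere) ≤ W t := by
    intro t ht
    have h1 : 0 ≤ ∫ x in closedBall (0:E) t, ((1:ℝ)/2 * ‖gradient f x‖ ^ 2 + D 0 * f x ^ g 0) ∂ν := by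
      refine setIntegral_nonneg measurableSet_closedBall fun x hx => ?_
      have h2 := h.nn x (closedBall_subset_closedBall (ht.2.le.trans hρ2ρ) hx)
      have h3 := h.D_nn 0
      have h4 := rpow_nonneg h2 (g 0)
      positivity
    have h2 : 0 ≤ t ^ (-N) := rpow_nonneg ht.1.le _
    have h3 : 0 ≤ C * t ^ s := mul_nonneg hC (rpow_nonneg ht.1.le _)
    have h4 := mul_nonneg h2 h1
    simp only [hWdef, weissW]
    linarith
  have hIoo : Ioo 0 ρ2 ∈ nhdsWithin (0:ℝ) (Ioi 0) := Ioo_mem_nhdsGT hρ2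
  have hbdd : BddBelow (W '' Ioo 0 ρ2) := by
    have hl1 := sphere_lim (ν := ν) hFc hu hconv one_pos one_pos 1 0
    have hl2 := hl1.const_mul (β / 2)
    set I0 := β / 2 * ∫ θ : sphere (0:E) 1, (1 * u₀ ((1:ℝ) • (θ:E)) - 0 * u₀ ((1:ℝ) • (θ:E))) ^ 2 ∂ν.toSphere with hI0
    have hl3 := hl2.eventually (gt_mem_nhds (lt_add_one I0))
    refine ⟨-(I0 + 1), ?_⟩
    rintro _ ⟨t, ht, rfl⟩
    have hev := (hscale 1 one_pos).eventually (Ioo_mem_nhdsGT ht.1)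
    obtain ⟨j, hj1, hj2⟩ := (hl3.and hev).exists
    have hj3 : 1 * r j ∈ Ioo 0 ρ2 := ⟨hj2.1, hj2.2.trans ht.2⟩
    have h5 := hmono hj3 ht hj2.2.le
    have h6 := hWlow _ hj3
    refine le_trans ?_ (h6.trans h5)
    have e : ∀ θ : sphere (0:E) 1, ((1 * r j) ^ (-β) * f ((1 * r j) • (θ:E))) = 1 * F j ((1:ℝ) • (θ:E)) - 0 * F j ((1:ℝ) • (θ:E)) := by
      intro θ; rw [hw j 1 θ one_pos]; simp
    simp only [e]
    linarith
  have hWlim := MonotoneOn.tendsto_nhdsWithin_Ioo_right (nonempty_Ioo.2 hρ2) hmono hbdd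
  -- equality on spheres
  have hsph : ∀ a b : ℝ, 0 < a → a < b → ∀ θ : sphere (0:E) 1, b ^ (-β) * u₀ (b • (θ:E)) = a ^ (-β) * u₀ (a • (θ:E)) := by
    intro a b ha hab
    have hb := ha.trans hab
    have hl := sphere_lim (ν := ν) hFc hu hconv hb ha (b ^ (-β)) (a ^ (-β))
    have hl0 : Filter.Tendsto (fun j => ((b - a) / a) * (2 * (W (b * r j) - W (a * r j)))) Filter.atTop (nhds 0) := by
      have := (((hWlim.comp (hscale b hb)).sub (hWlim.comp (hscale a ha))).const_mul 2).const_mul ((b - a) / a)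
      simpa using this
    have hle : (∫ θ : sphere (0:E) 1, (b ^ (-β) * u₀ (b • (θ:E)) - a ^ (-β) * u₀ (a • (θ:E))) ^ 2 ∂ν.toSphere) ≤ 0 := by
      refine le_of_tendsto_of_tendsto hl hl0 ?_
      filter_upwards [(hscale b hb).eventually hIoo] with j hj
      have hrj := hrpos j
      have h1 := w_diff_sq ν h.lip h.f0 hβ0 (mul_pos ha hrj) (mul_lt_mul_of_pos_right hab hrj)
      have h2 := hW (a * r j) (b * r j) (mul_pos ha hrj) (mul_le_mul_of_nonneg_right hab.le hrj.le) hj.2.le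
      simp only [hw j b _ hb, hw j a _ ha] at h1
      refine h1.trans ?_
      have e : (b * r j - a * r j) / (a * r j) = (b - a) / a := by field_simp
      rw [e]
      refine mul_le_mul_of_nonneg_left ?_ (div_nonneg (by linarith) ha.le)
      simp only [hWdef]
      linarith
    have hcont : Continuous (fun θ : sphere (0:E) 1 => (b ^ (-β) * u₀ (b • (θ:E)) - a ^ (-β) * u₀ (a • (θ:E))) ^ 2) := by fun_prop
    have hnn : 0 ≤ (fun θ : sphere (0:E) 1 => (b ^ (-β) * u₀ (b • (θ:E)) - a ^ (-β) * u₀ (a • (θ:E))) ^ 2) := fun θ => sq_nonneg _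
    have hz := (integral_eq_zero_iff_of_nonneg hnn (integrable_sphere_cont hcont)).1 (le_antisymm hle (integral_nonneg hnn))
    have hz2 := (Continuous.ae_eq_iff_eq ν.toSphere hcont continuous_const).1 hz
    intro θ
    have := congrFun hz2 θ
    exact sub_eq_zero.1 (pow_eq_zero_iff (two_ne_zero) |>.1 this)
  have hsph2 : ∀ a b : ℝ, 0 < a → 0 < b → ∀ θ : sphere (0:E) 1, b ^ (-β) * u₀ (b • (θ:E)) = a ^ (-β) * u₀ (a • (θ:E)) := by
    intro a b ha hb θ
    rcases lt_trichotomy a b with h1 | h1 | h1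
    · exact hsph a b ha h1 θ
    · rw [h1]
    · exact (hsph b a hb h1 θ).symm
  intro lam hlam x
  rcases eq_or_ne x 0 with rfl | hx
  · have h0 : u₀ 0 = 0 := by
      have h1 := (hconv {0} isCompact_singleton).tendsto_at (mem_singleton (0:E))
      have h1 : Filter.Tendsto (fun j => f (r j • (0:E)) / (r j) ^ β) Filter.atTop (nhds (u₀ 0)) := h1
      simp only [smul_zero, h.f0, zero_div] at h1
      exact tendsto_nhds_unique h1 tendsto_const_nhds
    simp [h0]
  · have hnx : 0 < ‖x‖ := norm_pos_iff.2 hx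
    have hθ : ‖x‖⁻¹ • x ∈ sphere (0:E) 1 := by
      rw [mem_sphere_zero_iff_norm, norm_smul, norm_inv, norm_norm, inv_mul_cancel₀ hnx.ne']
    have h1 := hsph2 ‖x‖ (lam * ‖x‖) hnx (mul_pos hlam hnx) ⟨_, hθ⟩
    simp only [smul_smul] at h1
    rw [mul_assoc, mul_inv_cancel₀ hnx.ne', mul_one, one_smul, mul_rpow hlam.le hnx.le, mul_comm (lam ^ (-β)), mul_assoc] at h1
    have h2 := mul_left_cancel₀ (rpow_pos_of_pos hnx _).ne' h1
    rw [← h2, rpow_neg hlam.le, ← mul_assoc, mul_inv_cancel₀ (rpow_pos_of_pos hlam _).ne', one_mul]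
end Concl

section Transfer

theorem gradient_translate {n : ℕ} (u : EuclideanSpace ℝ (Fin n) → ℝ) (z x : EuclideanSpace ℝ (Fin n)) :
    gradient (fun y => u (z + y)) x = gradient u (z + x) := by
  unfold gradient
  rw [fderiv_comp_add_left]

theorem energy_integrable {n : ℕ} {δ γ v : EuclideanSpace ℝ (Fin n) → ℝ} {M : ℝ} {K : NNReal}
    (hδm : Measurable δ) (hγm : Measurable γ) (hδM : ∀ x, δ x ≤ M) (hδ0 : ∀ x, 0 ≤ δ x)
    (hγ0 : ∀ x ∈ ball (0 : EuclideanSpace ℝ (Fin n)) 1, 0 ≤ γ x)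
    (hγ1 : ∀ x ∈ ball (0 : EuclideanSpace ℝ (Fin n)) 1, γ x ≤ 1) (hv : LipschitzWith K v) :
    IntegrableOn (fun x => (1:ℝ)/2 * ‖gradient v x‖ ^ 2 + δ x * (max (v x) 0) ^ (γ x)) (ball 0 1) := by
  obtain ⟨U, hU⟩ := (isCompact_closedBall (0 : EuclideanSpace ℝ (Fin n)) 1).exists_bound_of_continuousOn hv.continuous.continuousOn
  have hm : Measurable (fun x => (1:ℝ)/2 * ‖gradient v x‖ ^ 2 + δ x * (max (v x) 0) ^ (γ x)) := by
    have h1 := measurable_gradient' v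
    have h2 := hv.continuous.measurable
    fun_prop
  refine Integrable.mono' (g := fun _ => (1:ℝ)/2 * K ^ 2 + M * (1 + U)) ?_ hm.aestronglyMeasurable ?_
  · exact (integrableOn_const measure_ball_lt_top.ne)
  · filter_upwards [ae_restrict_mem measurableSet_ball] with x hx
    have hU' := hU x (ball_subset_closedBall hx)
    have hU0 : 0 ≤ U := (norm_nonneg _).trans hU'
    have h1 := norm_gradient_le_lip hv x
    have h0 : 0 ≤ max (v x) 0 := le_max_right _ _
    have h2 := rpow_bdd h0 (max_le ((le_abs_self _).trans hU') hU0) (hγ0 x hx) (hγ1 x hx)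
    have h3 := rpow_nonneg h0 (γ x)
    have h4 := hδ0 x
    rw [norm_eq_abs, abs_of_nonneg (by positivity)]
    have h5 : ‖gradient v x‖ ^ 2 ≤ (K:ℝ)^2 := pow_le_pow_left₀ (norm_nonneg _) h1 2
    have h6 : δ x * (max (v x) 0) ^ (γ x) ≤ M * (1 + U) := mul_le_mul (hδM x) h2 h3 (h4.trans (hδM x))
    linarith

theorem translate_integral {n : ℕ} (G : EuclideanSpace ℝ (Fin n) → ℝ) (z : EuclideanSpace ℝ (Fin n)) (R : ℝ) :
    ∫ x in closedBall 0 R, G (z + x) = ∫ y in closedBall z R, G y := by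
  have h1 := (measurePreserving_add_left (volume : Measure (EuclideanSpace ℝ (Fin n))) z).setIntegral_preimage_emb
    (MeasurableEquiv.addLeft z).measurableEmbedding G (closedBall z R)
  rw [← h1]
  congr 2
  ext x
  simp

theorem diff_lip {n : ℕ} {δ : EuclideanSpace ℝ (Fin n) → ℝ} {z : EuclideanSpace ℝ (Fin n)} (h : DifferentiableAt ℝ δ z) :
    ∃ C : ℝ, ∃ ε > 0, ∀ x ∈ closedBall (0 : EuclideanSpace ℝ (Fin n)) ε, |δ (z + x) - δ z| ≤ C * ‖x‖ := by
  obtain ⟨C, hC⟩ := h.isBigO_sub.bound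
  obtain ⟨ε, hε, hb⟩ := Metric.eventually_nhds_iff.1 hC
  refine ⟨C, ε / 2, by positivity, fun x hx => ?_⟩
  have hx' := mem_closedBall_zero_iff.1 hx
  have := hb (y := z + x) (by rw [dist_eq_norm, add_sub_cancel_left]; linarith)
  simpa using this

theorem integral_diff_add_integral_of_subset_aux {n : ℕ} {G : EuclideanSpace ℝ (Fin n) → ℝ} {A z : EuclideanSpace ℝ (Fin n)} {R s : ℝ}
    (hG : IntegrableOn G (ball A s)) (hsub : closedBall z R ⊆ ball A s) :
    (∫ x in ball A s \ closedBall z R, G x) + (∫ x in closedBall z R, G x) = ∫ x in ball A s, G x := by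
  rw [setIntegral_sdiff measurableSet_closedBall hG hsub]
  ring

theorem min_local {n : ℕ} {δ γ u : EuclideanSpace ℝ (Fin n) → ℝ} {M : ℝ}
    (hδm : Measurable δ) (hγm : Measurable γ) (hδM : ∀ x, δ x ≤ M) (hδ0 : ∀ x, 0 ≤ δ x)
    (hγ0 : ∀ x ∈ ball (0 : EuclideanSpace ℝ (Fin n)) 1, 0 ≤ γ x)
    (hγ1 : ∀ x ∈ ball (0 : EuclideanSpace ℝ (Fin n)) 1, γ x ≤ 1)
    (humin : IsLocalMinimizer δ γ u) {z : EuclideanSpace ℝ (Fin n)} {R : ℝ}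
    (hsub : closedBall z R ⊆ ball 0 1) {w : EuclideanSpace ℝ (Fin n) → ℝ} (hw : ∃ K, LipschitzWith K w)
    (hwu : ∀ x, x ∉ closedBall z R → w x = u x) :
    energyJ δ γ u (closedBall z R) ≤ energyJ δ γ w (closedBall z R) := by
  obtain ⟨⟨K, hu⟩, hmin⟩ := humin
  have h1 := hmin w hw ⟨closedBall z R, isCompact_closedBall _ _, hsub, fun x hx => by
    by_contra hc; exact hx (hwu x hc)⟩
  obtain ⟨K', hw⟩ := hw
  have i1 := energy_integrable hδm hγm hδM hδ0 hγ0 hγ1 hu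
  have i2 := energy_integrable hδm hγm hδM hδ0 hγ0 hγ1 hw
  unfold energyJ at *
  rw [← integral_diff_add_integral_of_subset_aux i1 hsub, ← integral_diff_add_integral_of_subset_aux i2 hsub] at h1
  have e : ∫ x in ball 0 1 \ closedBall z R, ((1:ℝ)/2 * ‖gradient u x‖ ^ 2 + δ x * (max (u x) 0) ^ (γ x)) =
     ∫ x in ball 0 1 \ closedBall z R, ((1:ℝ)/2 * ‖gradient w x‖ ^ 2 + δ x * (max (w x) 0) ^ (γ x)) := by
    refine setIntegral_congr_fun (measurableSet_ball.diff measurableSet_closedBall) fun x hx => ?_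
    have hev : w =ᶠ[nhds x] u := by
      filter_upwards [isClosed_closedBall.isOpen_compl.mem_nhds hx.2] with y hy
      exact hwu y hy
    have hg : gradient w x = gradient u x := by unfold gradient; rw [hev.fderiv_eq]
    simp only [hg, hwu x hx.2]
  linarith

end Transfer

theorem statement18 {n : ℕ} (hn : 2 ≤ n)
    (δ γ : EuclideanSpace ℝ (Fin n) → ℝ)
    (hδm : Measurable δ) (hγm : Measurable γ)
    (hδbd : ∃ M, ∀ x, |δ x| ≤ M) (hγbd : ∃ M, ∀ x, |γ x| ≤ M)
    (hδ0 : ∀ x, 0 ≤ δ x)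
    (hH1 : 0 < sInf (γ '' ball (0 : EuclideanSpace ℝ (Fin n)) 1))
    (hγ1 : ∀ x ∈ ball (0 : EuclideanSpace ℝ (Fin n)) 1, γ x ≤ 1)
    (δ₀ : ℝ) (hδ₀ : 0 < δ₀)
    (hδlow : ∀ x ∈ ball (0 : EuclideanSpace ℝ (Fin n)) 1, δ₀ ≤ δ x)
    (u : EuclideanSpace ℝ (Fin n) → ℝ)
    (humin : IsLocalMinimizer δ γ u)
    (hu01 : ∀ x ∈ ball (0 : EuclideanSpace ℝ (Fin n)) 1, 0 ≤ u x ∧ u x ≤ 1)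
    (hδdiff : DifferentiableOn ℝ δ (ball (0 : EuclideanSpace ℝ (Fin n)) 1))
    (hγdiff : DifferentiableOn ℝ γ (ball (0 : EuclideanSpace ℝ (Fin n)) 1))
    (μ : ℝ) (hμ : μ ∈ Ioo (0:ℝ) 1)
    (hHolder : ∃ Cγ, ∀ x ∈ ball (0 : EuclideanSpace ℝ (Fin n)) 1,
      ∀ y ∈ ball (0 : EuclideanSpace ℝ (Fin n)) 1, |γ x - γ y| ≤ Cγ * ‖x - y‖ ^ μ)
    (r₀ : ℝ) (hr₀ : r₀ ∈ Ioo (0:ℝ) (1/2))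
    (z₀ : EuclideanSpace ℝ (Fin n))
    (hz₀ : z₀ ∈ freeBoundary u ∩ ball (0 : EuclideanSpace ℝ (Fin n)) (1/2))
    (hIδ : IntegrableOn
      (fun t : ℝ => t ^ (-(n:ℝ)) * ∫ x in ball z₀ t, ‖gradient δ x‖)
      (Ioo (0:ℝ) r₀) volume)
    (hIγ : IntegrableOn
      (fun t : ℝ => t ^ (-(n:ℝ)) * |Real.log t| * ∫ x in ball z₀ t, ‖gradient γ x‖)
      (Ioo (0:ℝ) r₀) volume)
    (r : ℕ → ℝ) (hrpos : ∀ j, 0 < r j)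
    (hrlim : Filter.Tendsto r Filter.atTop (nhds 0))
    (u₀ : EuclideanSpace ℝ (Fin n) → ℝ) (hu₀cont : Continuous u₀)
    (hconv : ∀ K : Set (EuclideanSpace ℝ (Fin n)), IsCompact K →
      TendstoUniformlyOn
        (fun j x => u (z₀ + r j • x) / (r j) ^ (2 / (2 - γ z₀)))
        u₀ Filter.atTop K) :
    ∀ lam : ℝ, 0 < lam → ∀ x : EuclideanSpace ℝ (Fin n),
      u₀ (lam • x) = lam ^ (2 / (2 - γ z₀)) * u₀ x := by
  obtain ⟨M, hM⟩ := hδbd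
  obtain ⟨Mγ, hMγ⟩ := hγbd
  have hδM : ∀ x, δ x ≤ M := fun x => (le_abs_self _).trans (hM x)
  have hγs : ∀ x ∈ ball (0 : EuclideanSpace ℝ (Fin n)) 1, sInf (γ '' ball (0 : EuclideanSpace ℝ (Fin n)) 1) ≤ γ x := by
    intro x hx
    refine csInf_le ⟨-Mγ, ?_⟩ (mem_image_of_mem γ hx)
    rintro _ ⟨y, _, rfl⟩
    exact (abs_le.1 (hMγ y)).1
  have hγ0 : ∀ x ∈ ball (0 : EuclideanSpace ℝ (Fin n)) 1, 0 ≤ γ x := fun x hx => hH1.le.trans (hγs x hx)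
  obtain ⟨⟨hzF, hzB⟩, -⟩ := hz₀
  obtain ⟨K, hK⟩ := humin.1
  have huc := hK.continuous
  have huz : u z₀ = 0 := by
    have hop : IsOpen {x ∈ ball (0 : EuclideanSpace ℝ (Fin n)) 1 | 0 < u x} :=
      isOpen_ball.inter (isOpen_lt continuous_const huc)
    rw [hop.frontier_eq] at hzF
    refine le_antisymm ?_ (hu01 z₀ hzB).1
    by_contra hc
    exact hzF.2 ⟨hzB, not_le.1 hc⟩
  have hnh := isOpen_ball.mem_nhds hzB
  obtain ⟨Cδ, ε1, hε1, hL1⟩ := diff_lip (hδdiff.differentiableAt hnh)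
  obtain ⟨Cγ, ε2, hε2, hL2⟩ := diff_lip (hγdiff.differentiableAt hnh)
  obtain ⟨ε3, hε3, hsub3⟩ := Metric.nhds_basis_closedBall.mem_iff.1 hnh
  set ρ := min (min ε1 ε2) (min ε3 1) with hρ
  have hρ0 : 0 < ρ := by positivity
  have hρ1 : ρ ≤ ε1 := (min_le_left _ _).trans (min_le_left _ _)
  have hρ2 : ρ ≤ ε2 := (min_le_left _ _).trans (min_le_right _ _)
  have hρ3 : ρ ≤ ε3 := (min_le_right _ _).trans (min_le_left _ _)
  have hρ4 : ρ ≤ 1 := (min_le_right _ _).trans (min_le_right _ _)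
  have hsub : ∀ R ≤ ρ, closedBall z₀ R ⊆ ball (0 : EuclideanSpace ℝ (Fin n)) 1 := fun R hR =>
    (closedBall_subset_closedBall (hR.trans hρ3)).trans hsub3
  have hin : ∀ x ∈ closedBall (0 : EuclideanSpace ℝ (Fin n)) ρ, z₀ + x ∈ ball (0 : EuclideanSpace ℝ (Fin n)) 1 := by
    intro x hx
    refine hsub ρ le_rfl ?_
    rw [mem_closedBall, dist_eq_norm, add_sub_cancel_left]
    exact mem_closedBall_zero_iff.1 hx
  have core : Core (volume : Measure (EuclideanSpace ℝ (Fin n))) (fun x => u (z₀ + x)) (fun x => δ (z₀ + x))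
      (fun x => γ (z₀ + x)) K ρ M (sInf (γ '' ball (0 : EuclideanSpace ℝ (Fin n)) 1)) (max Cδ Cγ) := by
    refine
      { lip := ?_
        f0 := by simpa using huz
        nn := fun x hx => (hu01 _ (hin x hx)).1
        rho_pos := hρ0
        rho_le := hρ4
        Dm := hδm.comp (measurable_const_add z₀)
        gm := hγm.comp (measurable_const_add z₀)
        D_nn := fun x => hδ0 _
        D_le := fun x => hδM _
        gs_pos := hH1
        g_ge := fun x hx => hγs _ (hin x hx)
        g_le := fun x hx => hγ1 _ (hin x hx)
        D_lip := ?_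
        g_lip := ?_
        isMin := ?_ }
    · refine LipschitzWith.of_dist_le_mul fun x y => ?_
      have := hK.dist_le_mul (z₀ + x) (z₀ + y)
      rwa [dist_add_left] at this
    · intro x hx
      have h1 := hL1 x (closedBall_subset_closedBall hρ1 hx)
      simp only [add_zero]
      exact h1.trans (mul_le_mul_of_nonneg_right (le_max_left _ _) (norm_nonneg _))
    · intro x hx
      have h1 := hL2 x (closedBall_subset_closedBall hρ2 hx)
      simp only [add_zero]
      exact h1.trans (mul_le_mul_of_nonneg_right (le_max_right _ _) (norm_nonneg _))
    · rintro R ⟨hR0, hR⟩ v ⟨K', hv⟩ hvf hv0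
      set w : EuclideanSpace ℝ (Fin n) → ℝ := fun y => v (y - z₀) with hw
      have hwl : ∃ K, LipschitzWith K w := ⟨K', LipschitzWith.of_dist_le_mul fun x y => by
        have := hv.dist_le_mul (x - z₀) (y - z₀)
        rwa [dist_sub_right] at this⟩
      have hvw : v = fun x => w (z₀ + x) := by ext x; simp [hw]
      have hmin := min_local hδm hγm hδM hδ0 hγ0 hγ1 humin (hsub R hR) hwl (fun y hy => by
        have h1 := hvf (y - z₀) (by
          rw [mem_closedBall_zero_iff, ← dist_eq_norm]; exact hy)
        simpa [hw] using h1)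
      unfold energyJ at hmin
      rw [← translate_integral (fun x => (1:ℝ)/2 * ‖gradient u x‖ ^ 2 + δ x * (max (u x) 0) ^ (γ x)) z₀ R,
        ← translate_integral (fun x => (1:ℝ)/2 * ‖gradient w x‖ ^ 2 + δ x * (max (w x) 0) ^ (γ x)) z₀ R] at hmin
      convert hmin using 1
      · refine setIntegral_congr_fun measurableSet_closedBall fun x hx => ?_
        have h1 := (hu01 _ (hin x (closedBall_subset_closedBall hR hx))).1
        simp only [gradient_translate, max_eq_left h1]
      · refine setIntegral_congr_fun measurableSet_closedBall fun x hx => ?_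
        have h1 := hv0 x hx
        rw [hvw] at h1 ⊢
        simp only [gradient_translate] at h1 ⊢
        rw [max_eq_left h1]
  have : Nonempty (Fin n) := ⟨⟨0, by omega⟩⟩
  exact core.homog (by simpa using hn) (β := 2 / (2 - γ z₀)) (by simp) r hrpos hrlim u₀ hu₀cont hconv

end
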